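/- arXiv:2407.13736 — 6 statements merged into one kernel-verified Lean document; each statement's English description precedes it below -/
import Mathlib

section
/- Let Q > 0 and B > 2 be real numbers and let R > 0. Then there exists a constant c > 0, depending only on Q, B and R, such that for every Lebesgue-measurable function t : (0,∞) → (0, 4/Q²) and all s, s' ∈ (0, R] with s ≠ s', the truncated oscillatory integrals satisfy, uniformly for every X > max{B/s, B/s'}: |∫_{max{B/s, B/s'}}^{X} (λ² + Q²/4)^{-1/4} · e^{i(λ(s−s') + (t(s)−t(s'))(λ² + Q²/4))} dλ| ≤ c |s − s'|^{-1/2}. -/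
open Set MeasureTheory

namespace OscillatoryEstimate

/-- Mean value inequality: if `‖H'‖ ≤ W'` on `[p, q]`, then the increment of `H` is at most that
of `W`. -/
theorem norm_sub_le_sub_of_norm_deriv_le {H H' : ℝ → ℂ} {W W' : ℝ → ℝ} {p q : ℝ} (hpq : p ≤ q)
    (hH : ∀ x ∈ Icc p q, HasDerivAt H (H' x) x) (hW : ∀ x ∈ Icc p q, HasDerivAt W (W' x) x)
    (hle : ∀ x ∈ Icc p q, ‖H' x‖ ≤ W' x) : ‖H q - H p‖ ≤ W q - W p := by
  refine image_norm_le_of_norm_deriv_right_le_deriv_boundary' (f := fun x => H x - H p)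
    (f' := H') (B := fun x => W x - W p) (B' := W') (a := p) (b := q)
    ?_ ?_ ?_ ?_ ?_ ?_ (right_mem_Icc.2 hpq)
  · exact fun x hx => ((hH x hx).sub_const _).continuousAt.continuousWithinAt
  · exact fun x hx => ((hH x (Ico_subset_Icc_self hx)).sub_const _).hasDerivWithinAt
  · simp
  · exact fun x hx => ((hW x hx).sub_const _).continuousAt.continuousWithinAt
  · exact fun x hx => ((hW x (Ico_subset_Icc_self hx)).sub_const _).hasDerivWithinAt
  · exact fun x hx => hle x (Ico_subset_Icc_self hx)

theorem norm_integral_le_sub_of_norm_le {f : ℝ → ℂ} (hf : Continuous f) {W W' : ℝ → ℝ} {p q : ℝ}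
    (hpq : p ≤ q) (hW : ∀ x ∈ Icc p q, HasDerivAt W (W' x) x)
    (hle : ∀ x ∈ Icc p q, ‖f x‖ ≤ W' x) : ‖∫ x in p..q, f x‖ ≤ W q - W p := by
  simpa using norm_sub_le_sub_of_norm_deriv_le (H := fun x => ∫ y in p..x, f y) hpq
    (fun x _ => intervalIntegral.integral_hasDerivAt_right (hf.intervalIntegrable _ _)
      (hf.stronglyMeasurableAtFilter _ _) hf.continuousAt) hW hle

/-- All integrals of `f` over compact intervals inside `S` are bounded by `C`. -/
def IntegralsBoundedOn (f : ℝ → ℂ) (S : Set ℝ) (C : ℝ) : Prop :=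
  ∀ p q : ℝ, p ≤ q → Icc p q ⊆ S → ‖∫ x in p..q, f x‖ ≤ C

theorem IntegralsBoundedOn.split {f : ℝ → ℂ} (hf : Continuous f) {S : Set ℝ} (y : ℝ) {C₁ C₂ : ℝ}
    (hC₁ : 0 ≤ C₁) (hC₂ : 0 ≤ C₂)
    (h₁ : IntegralsBoundedOn f (S ∩ Iic y) C₁) (h₂ : IntegralsBoundedOn f (S ∩ Ici y) C₂) :
    IntegralsBoundedOn f S (C₁ + C₂) := by
  intro p q hpq hS
  rcases le_total q y with hq | hq
  · linarith [h₁ p q hpq fun x hx => ⟨hS hx, hx.2.trans hq⟩]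
  rcases le_total y p with hp | hp
  · linarith [h₂ p q hpq fun x hx => ⟨hS hx, hp.trans hx.1⟩]
  rw [← intervalIntegral.integral_add_adjacent_intervals (hf.intervalIntegrable p y)
    (hf.intervalIntegrable y q)]
  exact (norm_add_le _ _).trans (add_le_add
    (h₁ p y hp fun x hx => ⟨hS ⟨hx.1, hx.2.trans hq⟩, hx.2⟩)
    (h₂ y q hq fun x hx => ⟨hS ⟨hp.trans hx.1, hx.2⟩, hx.1⟩))

/-- The integrand with amplitude `a`, and phase `d l + τ (l² + r)`. -/
noncomputable def integrand (a : ℝ → ℝ) (d τ r : ℝ) (l : ℝ) : ℂ :=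
  (a l : ℂ) * Complex.exp (Complex.I * ((l * d + τ * (l ^ 2 + r) : ℝ) : ℂ))

theorem continuous_integrand {a : ℝ → ℝ} (ha : Continuous a) (d τ r : ℝ) :
    Continuous (integrand a d τ r) := by
  unfold integrand
  fun_prop

theorem norm_integrand (a : ℝ → ℝ) (d τ r l : ℝ) : ‖integrand a d τ r l‖ = |a l| := by
  rw [integrand, norm_mul, Complex.norm_exp_I_mul_ofReal]
  simp

/-- First derivative test of van der Corput for quadratic phases and decreasing amplitudes. -/
theorem norm_integral_integrand_le {a a' : ℝ → ℝ} (ha : ∀ x, HasDerivAt a (a' x) x)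
    {d τ r K m p q : ℝ} (hpq : p ≤ q) (hm : 0 < m)
    (hφ : ∀ x ∈ Icc p q, m ≤ |d + 2 * τ * x|) (ha0 : ∀ x ∈ Icc p q, 0 ≤ a x)
    (haK : ∀ x ∈ Icc p q, a x ≤ K) (ha' : ∀ x ∈ Icc p q, a' x ≤ 0) :
    ‖∫ x in p..q, integrand a d τ r x‖ ≤ 5 * K / m := by
  have hac : Continuous a := continuous_iff_continuousAt.2 fun x => (ha x).continuousAt
  have hf := continuous_integrand hac d τ r
  have hp := left_mem_Icc.2 hpq
  have hq := right_mem_Icc.2 hpq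
  have hK : 0 ≤ K := (ha0 p hp).trans (haK p hp)
  have hne : ∀ x ∈ Icc p q, d + 2 * τ * x ≠ 0 := fun x hx h => by
    have := hφ x hx
    rw [h, abs_zero] at this
    linarith
  obtain ⟨ε, hε, hετ⟩ : ∃ ε : ℝ, |ε| = 1 ∧ |2 * τ| = ε * (2 * τ) := by
    rcases abs_cases (2 * τ) with h | h
    · exact ⟨1, by simp, by linarith⟩
    · exact ⟨-1, by simp, by linarith⟩
  set G : ℝ → ℂ := fun x =>
    integrand a d τ r x / (Complex.I * ((d + 2 * τ * x : ℝ) : ℂ)) with hG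
  set E : ℝ → ℂ := fun x =>
    ((a' x * (d + 2 * τ * x)⁻¹ - a x * (2 * τ) / (d + 2 * τ * x) ^ 2 : ℝ) : ℂ) *
      Complex.exp (Complex.I * ((x * d + τ * (x ^ 2 + r) : ℝ) : ℂ)) / Complex.I with hE
  have hφ' : ∀ x, HasDerivAt (fun x : ℝ => d + 2 * τ * x) (2 * τ) x := fun x => by
    simpa using ((hasDerivAt_id x).const_mul (2 * τ)).const_add d
  have hGd : ∀ x ∈ Icc p q, HasDerivAt G (integrand a d τ r x + E x) x := by
    intro x hx
    have h1 : HasDerivAt (fun x : ℝ => x * d + τ * (x ^ 2 + r)) (d + 2 * τ * x) x := by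
      have := ((hasDerivAt_id x).mul_const d).add
        ((((hasDerivAt_id x).pow 2).add_const r).const_mul τ)
      refine this.congr_deriv ?_
      simp
      ring
    have h2 := ((h1.ofReal_comp).const_mul Complex.I).cexp
    have h3 := ((ha x).ofReal_comp).mul h2
    have h4 := ((hφ' x).ofReal_comp).const_mul Complex.I
    have hc : ((d + 2 * τ * x : ℝ) : ℂ) ≠ 0 := by exact_mod_cast hne x hx
    have h5 := h3.div h4 (mul_ne_zero Complex.I_ne_zero hc)
    refine h5.congr_deriv ?_
    simp only [integrand, hE, Pi.mul_apply]
    have hI := Complex.I_ne_zero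
    generalize Complex.exp (Complex.I * ((x * d + τ * (x ^ 2 + r) : ℝ) : ℂ)) = e
    push_cast at hc ⊢
    field_simp
    ring
  have hGn : ∀ x ∈ Icc p q, ‖G x‖ ≤ K / m := by
    intro x hx
    simp only [hG]
    rw [norm_div, norm_integrand, norm_mul, Complex.norm_I, one_mul, Complex.norm_real,
      Real.norm_eq_abs, abs_of_nonneg (ha0 x hx)]
    exact div_le_div₀ hK (haK x hx) hm (hφ x hx)
  have key := norm_sub_le_sub_of_norm_deriv_le
    (H := fun x => (∫ y in p..x, integrand a d τ r y) - G x) (H' := fun x => -E x)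
    (W := fun x => -(a x / m) - ε * K * (d + 2 * τ * x)⁻¹)
    (W' := fun x => -(a' x / m) - ε * K * (-(2 * τ) / (d + 2 * τ * x) ^ 2)) hpq
    (fun x hx => ((intervalIntegral.integral_hasDerivAt_right (hf.intervalIntegrable _ _)
      (hf.stronglyMeasurableAtFilter _ _) hf.continuousAt).sub (hGd x hx)).congr_deriv (by ring))
    (fun x hx => (((ha x).div_const m).neg).sub (((hφ' x).inv (hne x hx)).const_mul _)) ?_
  · simp only [intervalIntegral.integral_same, zero_sub] at key
    have hinv : ∀ x ∈ Icc p q, |ε * K * (d + 2 * τ * x)⁻¹| ≤ K / m := fun x hx => by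
      rw [abs_mul, abs_mul, hε, one_mul, abs_of_nonneg hK, abs_inv, ← div_eq_mul_inv]
      exact div_le_div_of_nonneg_left hK hm (hφ x hx)
    have hap : a p / m ≤ K / m := div_le_div_of_nonneg_right (haK p hp) hm.le
    have haq : 0 ≤ a q / m := div_nonneg (ha0 q hq) hm.le
    have e1 := abs_le.1 (hinv p hp)
    have e2 := abs_le.1 (hinv q hq)
    have n1 := hGn p hp
    have n2 := hGn q hq
    have : ∫ x in p..q, integrand a d τ r x
        = ((∫ x in p..q, integrand a d τ r x) - G q - -G p) + G q - G p := by ring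
    rw [this]
    have t1 := norm_sub_le ((∫ x in p..q, integrand a d τ r x) - G q - -G p + G q) (G p)
    have t2 := norm_add_le ((∫ x in p..q, integrand a d τ r x) - G q - -G p) (G q)
    have e5 : 5 * K / m = 5 * (K / m) := by ring
    rw [e5]
    linarith
  · intro x hx
    simp only [hE]
    rw [norm_neg, norm_div, norm_mul, Complex.norm_exp_I_mul_ofReal, Complex.norm_I, mul_one,
      div_one, Complex.norm_real, Real.norm_eq_abs]
    have hpos : 0 < (d + 2 * τ * x) ^ 2 := by have := hne x hx; positivity
    have b1 : |a' x * (d + 2 * τ * x)⁻¹| ≤ -(a' x / m) := by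
      rw [abs_mul, abs_of_nonpos (ha' x hx), abs_inv, ← div_eq_mul_inv, ← neg_div]
      exact div_le_div_of_nonneg_left (by linarith [ha' x hx]) hm (hφ x hx)
    have b2 : |a x * (2 * τ) / (d + 2 * τ * x) ^ 2|
        ≤ - (ε * K * (-(2 * τ) / (d + 2 * τ * x) ^ 2)) := by
      rw [abs_div, abs_mul, abs_of_pos hpos, abs_of_nonneg (ha0 x hx)]
      calc a x * |2 * τ| / (d + 2 * τ * x) ^ 2 ≤ K * |2 * τ| / (d + 2 * τ * x) ^ 2 := by
            have := haK x hx
            gcongr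
        _ = _ := by rw [hετ]; ring
    linarith [abs_sub (a' x * (d + 2 * τ * x)⁻¹) (a x * (2 * τ) / (d + 2 * τ * x) ^ 2)]

/-- If the amplitude decreases and is `O(x ^ (-1/2))`, then the integrals are `O(|d| ^ (-1/2))`
uniformly in `τ`. -/
theorem integralsBoundedOn_integrand {a a' : ℝ → ℝ} (ha : ∀ x, HasDerivAt a (a' x) x)
    (ha0 : ∀ x, 0 < x → 0 ≤ a x) (ha' : ∀ x, 0 < x → a' x ≤ 0)
    (haK : ∀ x, 0 < x → a x ≤ 1 / √x) {d : ℝ} (hd : d ≠ 0) (τ r : ℝ) :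
    IntegralsBoundedOn (integrand a d τ r) (Ioi 0) (36 / √|d|) := by
  have hac : Continuous a := continuous_iff_continuousAt.2 fun x => (ha x).continuousAt
  have hf := continuous_integrand hac d τ r
  obtain ⟨D, hDdef⟩ : ∃ D, D = √|d| := ⟨_, rfl⟩
  have hD : 0 < D := hDdef ▸ Real.sqrt_pos.2 (abs_pos.2 hd)
  have hD2 : |d| = D ^ 2 := by rw [hDdef, Real.sq_sqrt (abs_nonneg d)]
  rw [← hDdef]
  have hak : ∀ k x, 0 < k → k ^ 2 ≤ x → a x ≤ 1 / k := fun k x hk hx =>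
    (haK x (lt_of_lt_of_le (by positivity) hx)).trans
      (one_div_le_one_div_of_le hk (Real.le_sqrt_of_sq_le hx))
  have van : ∀ (S : Set ℝ) (k m : ℝ), 0 < k → 0 < m → (∀ x ∈ S, k ^ 2 ≤ x) →
      (∀ x ∈ S, m ≤ |d + 2 * τ * x|) →
      IntegralsBoundedOn (integrand a d τ r) S (5 * (1 / k) / m) := by
    intro S k m hk hm hS hφ p q hpq hsub
    have hpos : ∀ x ∈ Icc p q, 0 < x := fun x hx =>
      lt_of_lt_of_le (by positivity) (hS x (hsub hx))
    exact norm_integral_integrand_le ha hpq hm (fun x hx => hφ x (hsub hx))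
      (fun x hx => ha0 x (hpos x hx)) (fun x hx => hak k x hk (hS x (hsub hx)))
      (fun x hx => ha' x (hpos x hx))
  have low : IntegralsBoundedOn (integrand a d τ r) (Ioi 0 ∩ Iic ((1 / D) ^ 2)) (2 / D) := by
    intro p q hpq hsub
    have h := norm_integral_le_sub_of_norm_le hf (W := fun x => 2 * √x)
      (W' := fun x => 2 * (1 / (2 * √x))) hpq
      (fun x hx => (Real.hasDerivAt_sqrt (ne_of_gt (hsub hx).1)).const_mul 2)
      (fun x hx => by
        have hx0 : 0 < x := (hsub hx).1
        rw [norm_integrand, abs_of_nonneg (ha0 x hx0)]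
        refine (haK x hx0).trans (le_of_eq ?_)
        have := Real.sqrt_pos.2 hx0
        field_simp)
    have h2 : √q ≤ 1 / D := Real.sqrt_le_iff.2 ⟨by positivity, (hsub (right_mem_Icc.2 hpq)).2⟩
    have h3 := Real.sqrt_nonneg p
    have h4 : 2 / D = 2 * (1 / D) := by ring
    rw [h4]
    linarith
  have e36 : 36 / D = 2 / D + 34 / D := by ring
  rw [e36]
  refine IntegralsBoundedOn.split hf _ (by positivity) (by positivity) low ?_
  rcases le_or_gt 0 (d * τ) with hdt | hdt
  · have h := van (Ioi 0 ∩ Ici ((1 / D) ^ 2)) (1 / D) (D ^ 2) (by positivity) (by positivity)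
      (fun x hx => hx.2) (fun x hx => by
        rw [← hD2]
        have hx0 : 0 < x := hx.1
        refine sq_le_sq.1 ?_
        nlinarith [mul_nonneg hdt hx0.le, sq_nonneg (τ * x)])
    intro p q hpq hsub
    refine (h p q hpq hsub).trans ?_
    have : 5 * (1 / (1 / D)) / D ^ 2 = 5 / D := by field_simp
    rw [this]
    gcongr
    norm_num
  · have hτ : τ ≠ 0 := by rintro rfl; simp at hdt
    obtain ⟨T, hTdef⟩ : ∃ T, T = √|τ| := ⟨_, rfl⟩
    have hT : 0 < T := hTdef ▸ Real.sqrt_pos.2 (abs_pos.2 hτ)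
    have hT2 : |τ| = T ^ 2 := by rw [hTdef, Real.sq_sqrt (abs_nonneg τ)]
    have hφ : ∀ x, |d + 2 * τ * x| = |D ^ 2 - 2 * T ^ 2 * x| := by
      intro x
      rw [← hD2, ← hT2]
      rcases lt_or_gt_of_ne hd with h | h
      · have : 0 < τ := by by_contra hh; nlinarith
        rw [abs_of_neg h, abs_of_pos this, ← abs_neg]
        congr 1
        ring
      · have : τ < 0 := by by_contra hh; nlinarith
        rw [abs_of_pos h, abs_of_neg this]
        congr 1
        ring
    have hu : T ^ 2 * (D / (2 * T)) ^ 2 = D ^ 2 / 4 := by field_simp; norm_num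
    have hTT : T ^ 2 * (1 / T) = T := by field_simp
    have hT2pos : 0 < T ^ 2 := by positivity
    set u := (D / (2 * T)) ^ 2 with hudef
    have e34 : 34 / D = 10 / D + (5 / D + (4 / D + (5 / D + 10 / D))) := by ring
    rw [e34]
    have c10 : 5 * (1 / (1 / D)) / (D ^ 2 / 2) = 10 / D := by field_simp; norm_num
    have c5 : 5 * (1 / (D / (2 * T))) / (2 * T) = 5 / D := by field_simp
    refine IntegralsBoundedOn.split hf u (by positivity) (by positivity) ?_
      (IntegralsBoundedOn.split hf (2 * u - 1 / T) (by positivity) (by positivity) ?_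
        (IntegralsBoundedOn.split hf (2 * u + 1 / T) (by positivity) (by positivity) ?_
          (IntegralsBoundedOn.split hf (3 * u) (by positivity) (by positivity) ?_ ?_)))
    · rw [← c10]
      refine van _ _ _ (by positivity) (by positivity) (fun x hx => hx.1.2) (fun x hx => ?_)
      have h1 : x ≤ u := hx.2
      rw [hφ]
      refine le_trans ?_ (le_abs_self _)
      nlinarith
    · rw [← c5]
      refine van _ _ _ (by positivity) (by positivity) (fun x hx => hx.1.2) (fun x hx => ?_)
      have h1 : x ≤ 2 * u - 1 / T := hx.2
      rw [hφ]
      refine le_trans ?_ (le_abs_self _)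
      nlinarith
    · intro p q hpq hsub
      have hp := (hsub (left_mem_Icc.2 hpq)).1.2
      have hq := (hsub (right_mem_Icc.2 hpq)).2
      simp only [mem_Ici, mem_Iic] at hp hq
      have h := intervalIntegral.norm_integral_le_of_norm_le_const
        (f := integrand a d τ r) (a := p) (b := q) (C := 1 / (D / (2 * T))) (fun x hx => by
          rw [uIoc_of_le hpq] at hx
          have hx' := hsub (Ioc_subset_Icc_self hx)
          rw [norm_integrand, abs_of_nonneg (ha0 x hx'.1.1.1.1)]
          exact hak _ _ (by positivity) hx'.1.1.2)
      rw [abs_of_nonneg (by linarith)] at h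
      refine h.trans ?_
      calc 1 / (D / (2 * T)) * (q - p) ≤ 1 / (D / (2 * T)) * (2 * (1 / T)) := by
            gcongr
            linarith
        _ = 4 / D := by field_simp; norm_num
    · rw [← c5]
      refine van _ _ _ (by positivity) (by positivity) (fun x hx => hx.1.1.1.2) (fun x hx => ?_)
      have h1 : 2 * u + 1 / T ≤ x := hx.1.2
      rw [hφ, abs_sub_comm]
      refine le_trans ?_ (le_abs_self _)
      nlinarith
    · rw [← c10]
      refine van _ _ _ (by positivity) (by positivity) (fun x hx => hx.1.1.1.1.2)
        (fun x hx => ?_)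
      have h1 : 3 * u ≤ x := hx.2
      rw [hφ, abs_sub_comm]
      refine le_trans ?_ (le_abs_self _)
      nlinarith

theorem hasDerivAt_amplitude {r : ℝ} (hr : 0 < r) (x : ℝ) :
    HasDerivAt (fun x : ℝ => (x ^ 2 + r) ^ (-(1 / 4 : ℝ)))
      (2 * x * (-(1 / 4)) * (x ^ 2 + r) ^ (-(1 / 4 : ℝ) - 1)) x := by
  have h : HasDerivAt (fun x : ℝ => x ^ 2 + r) (2 * x) x := by
    simpa using (hasDerivAt_pow 2 x).add_const r
  exact h.rpow_const (Or.inl (by positivity))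

theorem amplitude_le {r : ℝ} (hr : 0 < r) {x : ℝ} (hx : 0 < x) :
    (x ^ 2 + r) ^ (-(1 / 4 : ℝ)) ≤ 1 / √x := by
  calc (x ^ 2 + r) ^ (-(1 / 4 : ℝ)) ≤ (x ^ 2) ^ (-(1 / 4 : ℝ)) :=
        Real.rpow_le_rpow_of_nonpos (by positivity) (by linarith) (by norm_num)
    _ = 1 / √x := by
        rw [← Real.rpow_natCast, ← Real.rpow_mul hx.le, Real.sqrt_eq_rpow, one_div (x ^ _),
          ← Real.rpow_neg hx.le]
        norm_num

end OscillatoryEstimate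

open OscillatoryEstimate


/-- **Oscillatory integral estimate (Lemma 3.1).**
Let `Q > 0`, `B > 2`, `R > 0`. There is a constant `c > 0` (depending only on `Q`, `B`, `R`)
such that for every measurable `t : (0,∞) → (0, 4/Q²)` and all `s, s' ∈ (0, R]` with `s ≠ s'`,
uniformly in every upper truncation `X > max (B/s) (B/s')`,
`|∫_{max(B/s, B/s')}^{X} (λ² + Q²/4)^{-1/4} e^{i(λ(s-s') + (t(s)-t(s'))(λ² + Q²/4))} dλ|
  ≤ c |s - s'|^{-1/2}`. -/
theorem oscillatory_integral_estimate
    (Q B R : ℝ) (hQ : 0 < Q) (hB : 2 < B) (hR : 0 < R) :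
    ∃ c : ℝ, 0 < c ∧
      ∀ t : ℝ → ℝ, Measurable t → (∀ u : ℝ, 0 < u → t u ∈ Set.Ioo 0 (4 / Q ^ 2)) →
      ∀ s s' : ℝ, s ∈ Set.Ioc 0 R → s' ∈ Set.Ioc 0 R → s ≠ s' →
      ∀ X : ℝ, max (B / s) (B / s') < X →
      ‖∫ l in (max (B / s) (B / s'))..X,
          (((l ^ 2 + Q ^ 2 / 4) ^ (-(1 / 4 : ℝ)) : ℝ) : ℂ) *
            Complex.exp (Complex.I *
              ((l * (s - s') + (t s - t s') * (l ^ 2 + Q ^ 2 / 4) : ℝ) : ℂ))‖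
        ≤ c * |s - s'| ^ (-(1 / 2 : ℝ)) := by
  refine ⟨36, by norm_num, fun t _ _ s s' hs hs' hne X hX => ?_⟩
  have hr : 0 < Q ^ 2 / 4 := by positivity
  have hpos : 0 < max (B / s) (B / s') := lt_max_of_lt_left (div_pos (by linarith) hs.1)
  have h := integralsBoundedOn_integrand (hasDerivAt_amplitude hr)
    (fun x _ => by positivity)
    (fun x hx => mul_nonpos_of_nonpos_of_nonneg (by linarith) (by positivity))
    (fun x hx => amplitude_le hr hx) (sub_ne_zero.2 hne) (t s - t s') (Q ^ 2 / 4)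
    _ X hX.le (fun x hx => hpos.trans_le hx.1)
  rw [Real.rpow_neg (abs_nonneg _), ← Real.sqrt_eq_rpow, ← div_eq_mul_inv]
  exact h
end

section
/- Let B > 2 and L > 0. There exists a constant c > 0, depending only on B and L, such that for every Lebesgue-measurable function τ : (0,∞) → (0,1) and all s, s' ∈ (0, L] with s ≠ s', the truncated oscillatory integrals satisfy, uniformly for every X > max{B/s, B/s'}: |∫_{max{B/s, B/s'}}^{X} (1 + r²)^{-1/4} · e^{i(r(s−s') + (τ(s)−τ(s')) r²)} dr| ≤ c |s − s'|^{-1/2}. -/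
open MeasureTheory Set

/-- The integrals of `f` over all intervals with endpoints in `S` are bounded by `A`. -/
def IntegralBoundOn (f : ℝ → ℂ) (S : Set ℝ) (A : ℝ) : Prop :=
  ∀ p ∈ S, ∀ q ∈ S, p ≤ q → ‖∫ r in p..q, f r‖ ≤ A

namespace IntegralBoundOn

variable {f : ℝ → ℂ} {S T : Set ℝ} {A A' : ℝ}

lemma mono (h : IntegralBoundOn f S A) (hT : T ⊆ S) (hA : A ≤ A') : IntegralBoundOn f T A' :=
  fun p hp q hq hpq => (h p (hT hp) q (hT hq) hpq).trans hA

lemma split (hf : Continuous f) {c : ℝ} (hc : c ∈ S) (h₁ : IntegralBoundOn f (S ∩ Iic c) A)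
    (h₂ : IntegralBoundOn f (S ∩ Ici c) A') : IntegralBoundOn f S (A + A') := by
  have hA : 0 ≤ A := (norm_nonneg _).trans (h₁ c ⟨hc, le_refl c⟩ c ⟨hc, le_refl c⟩ le_rfl)
  have hA' : 0 ≤ A' := (norm_nonneg _).trans (h₂ c ⟨hc, le_refl c⟩ c ⟨hc, le_refl c⟩ le_rfl)
  intro p hp q hq hpq
  rcases le_total q c with hqc | hcq
  · exact (h₁ p ⟨hp, hpq.trans hqc⟩ q ⟨hq, hqc⟩ hpq).trans (by linarith)
  rcases le_total c p with hcp | hpc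
  · exact (h₂ p ⟨hp, hcp⟩ q ⟨hq, hcq⟩ hpq).trans (by linarith)
  rw [← intervalIntegral.integral_add_adjacent_intervals (hf.intervalIntegrable p c)
    (hf.intervalIntegrable c q)]
  exact (norm_add_le _ _).trans
    (add_le_add (h₁ p ⟨hp, hpc⟩ c ⟨hc, le_refl c⟩ hpc) (h₂ c ⟨hc, le_refl c⟩ q ⟨hq, hcq⟩ hcq))

/-- Splitting a set at a point that need not belong to it, for bounds that are known to be
nonnegative. -/
lemma split' (hf : Continuous f) {c : ℝ} (hS : S.OrdConnected) (hA : 0 ≤ A) (hA' : 0 ≤ A')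
    (h₁ : IntegralBoundOn f (S ∩ Iic c) A)
    (h₂ : IntegralBoundOn f (S ∩ Ici c) A') : IntegralBoundOn f S (A + A') := by
  by_cases hc : c ∈ S
  · exact split hf hc h₁ h₂
  intro p hp q hq hpq
  rcases le_total q c with hqc | hcq
  · exact (h₁ p ⟨hp, hpq.trans hqc⟩ q ⟨hq, hqc⟩ hpq).trans (by linarith)
  rcases le_total c p with hcp | hpc
  · exact (h₂ p ⟨hp, hcp⟩ q ⟨hq, hcq⟩ hpq).trans (by linarith)
  exact absurd (hS.out hp hq ⟨hpc, hcq⟩) hc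

/-- Multiplying by a nonnegative antitone `C¹` weight costs its value at the left endpoint. -/
lemma norm_integral_weight_mul_le {p q K : ℝ} {g g' : ℝ → ℝ} (hpq : p ≤ q) (hf : Continuous f)
    (hg : ∀ r, HasDerivAt g (g' r) r) (hg'c : Continuous g')
    (hg' : ∀ r ∈ Icc p q, g' r ≤ 0) (hgq : 0 ≤ g q)
    (h : IntegralBoundOn f (Icc p q) K) :
    ‖∫ r in p..q, (g r : ℂ) * f r‖ ≤ g p * K := by
  have hF : ∀ r, HasDerivAt (fun x => ∫ t in p..x, f t) (f r) r := fun r =>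
    hf.integral_hasStrictDerivAt p r |>.hasDerivAt
  have hFc : Continuous (fun x => ∫ t in p..x, f t) :=
    continuous_iff_continuousAt.2 fun r => (hF r).continuousAt
  have hK : ∀ r ∈ Icc p q, ‖∫ t in p..r, f t‖ ≤ K := fun r hr =>
    h p (left_mem_Icc.2 hpq) r hr hr.1
  have hparts := intervalIntegral.integral_mul_deriv_eq_deriv_mul
    (a := p) (b := q) (u := fun r => (g r : ℂ)) (u' := fun r => (g' r : ℂ))
    (v := fun x => ∫ t in p..x, f t) (v' := f)
    (fun r _ => (hg r).ofReal_comp) (fun r _ => hF r)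
    ((Complex.continuous_ofReal.comp hg'c).intervalIntegrable _ _) (hf.intervalIntegrable _ _)
  rw [hparts]
  have hint : ∫ r in p..q, -g' r * K = (g p - g q) * K := by
    rw [intervalIntegral.integral_mul_const, intervalIntegral.integral_neg,
      intervalIntegral.integral_eq_sub_of_hasDerivAt (fun r _ => hg r)
        (hg'c.intervalIntegrable _ _)]
    ring
  have h2 : ‖∫ r in p..q, (g' r : ℂ) * ∫ t in p..r, f t‖ ≤ (g p - g q) * K := by
    rw [← hint]
    refine intervalIntegral.norm_integral_le_of_norm_le hpq (Filter.Eventually.of_forall ?_)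
      ((hg'c.neg.mul continuous_const).intervalIntegrable _ _)
    intro r hr
    have hr' : r ∈ Icc p q := ⟨hr.1.le, hr.2⟩
    rw [norm_mul, Complex.norm_real, Real.norm_eq_abs, abs_of_nonpos (hg' r hr')]
    exact mul_le_mul_of_nonneg_left (hK r hr') (by linarith [hg' r hr'])
  have h1 : ‖(g q : ℂ) * ∫ t in p..q, f t‖ ≤ g q * K := by
    rw [norm_mul, Complex.norm_real, Real.norm_eq_abs, abs_of_nonneg hgq]
    exact mul_le_mul_of_nonneg_left (hK q (right_mem_Icc.2 hpq)) hgq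
  simp only [intervalIntegral.integral_same, mul_zero, sub_zero]
  calc _ ≤ g q * K + (g p - g q) * K := (norm_sub_le _ _).trans (add_le_add h1 h2)
    _ = g p * K := by ring

end IntegralBoundOn

/-- The oscillating factor with quadratic phase `a r + b r²`. -/
noncomputable def quadOsc (a b r : ℝ) : ℂ :=
  Complex.exp (Complex.I * ((r * a + b * r ^ 2 : ℝ) : ℂ))

lemma continuous_quadOsc (a b : ℝ) : Continuous (quadOsc a b) := by
  unfold quadOsc; fun_prop

lemma norm_quadOsc (a b r : ℝ) : ‖quadOsc a b r‖ = 1 := by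
  rw [quadOsc, mul_comm, Complex.norm_exp_ofReal_mul_I]

lemma hasDerivAt_quadOsc (a b r : ℝ) :
    HasDerivAt (quadOsc a b) (quadOsc a b r * (Complex.I * ((a + 2 * b * r : ℝ) : ℂ))) r := by
  have h : HasDerivAt (fun r : ℝ => r * a + b * r ^ 2) (a + 2 * b * r) r := by
    refine (((hasDerivAt_id r).mul_const a).add ((hasDerivAt_pow 2 r).const_mul b)).congr_deriv ?_
    norm_num
    ring
  exact (h.ofReal_comp.const_mul Complex.I).cexp

/-- First derivative test for a quadratic phase. -/
lemma integralBoundOn_quadOsc_of_le_abs {a b l : ℝ} (hl : 0 < l) {S : Set ℝ} (hS : S.OrdConnected)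
    (h : ∀ r ∈ S, l ≤ |a + 2 * b * r|) : IntegralBoundOn (quadOsc a b) S (4 / l) := by
  intro p hp q hq hpq
  have hmem : ∀ r ∈ uIcc p q, r ∈ S := fun r hr => hS.out hp hq (by rwa [uIcc_of_le hpq] at hr)
  have hne : ∀ r ∈ uIcc p q, a + 2 * b * r ≠ 0 := fun r hr h0 => by
    have := h r (hmem r hr); rw [h0, abs_zero] at this; linarith
  have hlin : ∀ r : ℝ, HasDerivAt (fun r => a + 2 * b * r) (2 * b) r := fun r => by
    simpa using ((hasDerivAt_id r).const_mul (2 * b)).const_add a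
  have hinv : ∀ r ∈ uIcc p q,
      HasDerivAt (fun r => (a + 2 * b * r)⁻¹) (-(2 * b) / (a + 2 * b * r) ^ 2) r := fun r hr =>
    (hlin r).inv (hne r hr)
  have hcont : ContinuousOn (fun r => -(2 * b) / (a + 2 * b * r) ^ 2) (uIcc p q) :=
    continuousOn_const.div (by fun_prop) fun r hr => pow_ne_zero 2 (hne r hr)
  have hiinv : IntervalIntegrable (fun r => -(2 * b) / (a + 2 * b * r) ^ 2) volume p q :=
    hcont.intervalIntegrable
  have hbd : ∀ r ∈ S, |(a + 2 * b * r)⁻¹| ≤ 1 / l := fun r hr => by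
    rw [abs_inv, ← one_div]; exact one_div_le_one_div_of_le hl (h r hr)
  have hparts := intervalIntegral.integral_mul_deriv_eq_deriv_mul
    (a := p) (b := q) (u := fun r => (((a + 2 * b * r)⁻¹ : ℝ) : ℂ))
    (u' := fun r => ((-(2 * b) / (a + 2 * b * r) ^ 2 : ℝ) : ℂ))
    (v := quadOsc a b) (v' := fun r => quadOsc a b r * (Complex.I * ((a + 2 * b * r : ℝ) : ℂ)))
    (fun r hr => (hinv r hr).ofReal_comp) (fun r _ => hasDerivAt_quadOsc a b r)
    (Complex.continuous_ofReal.comp_continuousOn hcont).intervalIntegrable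
    (((continuous_quadOsc a b).mul (by fun_prop)).intervalIntegrable _ _)
  have hlhs : ∫ r in p..q, (((a + 2 * b * r)⁻¹ : ℝ) : ℂ) *
      (quadOsc a b r * (Complex.I * ((a + 2 * b * r : ℝ) : ℂ))) =
      Complex.I * ∫ r in p..q, quadOsc a b r := by
    rw [← intervalIntegral.integral_const_mul]
    refine intervalIntegral.integral_congr fun r hr => ?_
    have : ((a + 2 * b * r : ℝ) : ℂ) ≠ 0 := Complex.ofReal_ne_zero.2 (hne r hr)
    simp only [Complex.ofReal_inv]
    field_simp
  have hrem : ‖∫ r in p..q, ((-(2 * b) / (a + 2 * b * r) ^ 2 : ℝ) : ℂ) * quadOsc a b r‖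
      ≤ 2 / l := by
    obtain ⟨ε, hε, hεb⟩ : ∃ ε : ℝ, |ε| = 1 ∧ |2 * b| = ε * -(2 * b) := by
      rcases abs_choice (2 * b) with h | h
      · exact ⟨-1, by simp, by rw [h]; ring⟩
      · exact ⟨1, by simp, by rw [h]; ring⟩
    calc _ ≤ ∫ r in p..q, ε * (-(2 * b) / (a + 2 * b * r) ^ 2) := by
          refine intervalIntegral.norm_integral_le_of_norm_le hpq
            (Filter.Eventually.of_forall fun r _ => ?_) (hiinv.const_mul ε)
          rw [norm_mul, norm_quadOsc, mul_one, Complex.norm_real, Real.norm_eq_abs, abs_div,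
            abs_neg, hεb, abs_of_nonneg (sq_nonneg (a + 2 * b * r)), mul_div_assoc]
      _ = ε * ((a + 2 * b * q)⁻¹ - (a + 2 * b * p)⁻¹) := by
          rw [intervalIntegral.integral_const_mul,
            intervalIntegral.integral_eq_sub_of_hasDerivAt hinv hiinv]
      _ ≤ |ε * ((a + 2 * b * q)⁻¹ - (a + 2 * b * p)⁻¹)| := le_abs_self _
      _ ≤ 1 / l + 1 / l := by
          rw [abs_mul, hε, one_mul]
          exact (abs_sub _ _).trans (add_le_add (hbd q hq) (hbd p hp))
      _ = 2 / l := by ring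
  have hend : ∀ r ∈ S, ‖(((a + 2 * b * r)⁻¹ : ℝ) : ℂ) * quadOsc a b r‖ ≤ 1 / l := fun r hr => by
    rw [norm_mul, norm_quadOsc, mul_one, Complex.norm_real]; exact hbd r hr
  calc ‖∫ r in p..q, quadOsc a b r‖ = ‖Complex.I * ∫ r in p..q, quadOsc a b r‖ := by simp
    _ ≤ (1 / l + 1 / l) + 2 / l := by
        rw [← hlhs, hparts]
        exact (norm_sub_le _ _).trans
          (add_le_add ((norm_sub_le _ _).trans (add_le_add (hend q hq) (hend p hp))) hrem)
    _ = 4 / l := by ring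

/-- Second derivative test for a quadratic phase. -/
lemma integralBoundOn_quadOsc_univ (a : ℝ) {b : ℝ} (hb : b ≠ 0) :
    IntegralBoundOn (quadOsc a b) univ (6 / √|b|) := by
  have hs : 0 < √|b| := Real.sqrt_pos.2 (abs_pos.2 hb)
  have hss : √|b| * √|b| = |b| := Real.mul_self_sqrt (abs_nonneg b)
  set c := -a / (2 * b) with hc
  have hphase : ∀ r, |a + 2 * b * r| = 2 * |b| * |r - c| := fun r => by
    rw [show a + 2 * b * r = 2 * b * (r - c) by rw [hc]; field_simp; ring, abs_mul, abs_mul,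
      abs_two]
  have hout : ∀ r, 1 / √|b| ≤ |r - c| → 2 * √|b| ≤ |a + 2 * b * r| := fun r hr => by
    have := (div_le_iff₀ hs).1 hr
    calc 2 * √|b| ≤ 2 * √|b| * (|r - c| * √|b|) := le_mul_of_one_le_right (by positivity) this
      _ = 2 * (√|b| * √|b|) * |r - c| := by ring
      _ = |a + 2 * b * r| := by rw [hphase, hss]
  have hcont := continuous_quadOsc a b
  have h₁ : IntegralBoundOn (quadOsc a b) (univ ∩ Iic (c - 1 / √|b|)) (4 / (2 * √|b|)) := by
    refine integralBoundOn_quadOsc_of_le_abs (by positivity)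
      (ordConnected_univ.inter ordConnected_Iic) fun r hr => hout r ?_
    have : r ≤ c - 1 / √|b| := hr.2
    rw [abs_sub_comm]
    exact (by linarith : 1 / √|b| ≤ c - r).trans (le_abs_self _)
  have h₂ : IntegralBoundOn (quadOsc a b)
      ((univ ∩ Ici (c - 1 / √|b|)) ∩ Iic (c + 1 / √|b|)) (2 / √|b|) := by
    intro p hp q hq hpq
    have h1 : c - 1 / √|b| ≤ p := hp.1.2
    have h2 : q ≤ c + 1 / √|b| := hq.2
    have := intervalIntegral.norm_integral_le_of_norm_le_const (a := p) (b := q) (C := 1)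
      (f := quadOsc a b) fun r _ => (norm_quadOsc a b r).le
    rw [one_mul, abs_of_nonneg (sub_nonneg.2 hpq)] at this
    have h3 : 2 / √|b| = 1 / √|b| + 1 / √|b| := by ring
    linarith
  have h₃ : IntegralBoundOn (quadOsc a b)
      ((univ ∩ Ici (c - 1 / √|b|)) ∩ Ici (c + 1 / √|b|)) (4 / (2 * √|b|)) := by
    refine integralBoundOn_quadOsc_of_le_abs (by positivity)
      ((ordConnected_univ.inter ordConnected_Ici).inter ordConnected_Ici) fun r hr => hout r ?_
    have : c + 1 / √|b| ≤ r := hr.2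
    exact (by linarith : 1 / √|b| ≤ r - c).trans (le_abs_self _)
  refine (IntegralBoundOn.split' hcont ordConnected_univ (by positivity) (by positivity) h₁
    (IntegralBoundOn.split' hcont (ordConnected_univ.inter ordConnected_Ici) (by positivity)
      (by positivity) h₂ h₃)).mono Subset.rfl (le_of_eq ?_)
  field_simp
  norm_num

lemma hasDerivAt_one_add_sq_rpow (r : ℝ) :
    HasDerivAt (fun r : ℝ => (1 + r ^ 2) ^ (-(1 / 4 : ℝ)))
      (2 * r * (-(1 / 4)) * (1 + r ^ 2) ^ (-(1 / 4 : ℝ) - 1)) r := by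
  have h : HasDerivAt (fun r : ℝ => 1 + r ^ 2) (2 * r) r := by
    simpa using (hasDerivAt_pow 2 r).const_add 1
  exact h.rpow_const (Or.inl (by positivity))

lemma one_add_sq_rpow_le {m r : ℝ} (hm : 0 < m) (hr : m ≤ r) :
    (1 + r ^ 2) ^ (-(1 / 4 : ℝ)) ≤ 1 / √m := by
  calc (1 + r ^ 2) ^ (-(1 / 4 : ℝ)) ≤ (m ^ 2) ^ (-(1 / 4 : ℝ)) :=
        Real.rpow_le_rpow_of_nonpos (by positivity) (by nlinarith) (by norm_num)
    _ = 1 / √m := by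
        rw [← Real.rpow_natCast, ← Real.rpow_mul hm.le, Real.sqrt_eq_rpow, one_div (m ^ _),
          ← Real.rpow_neg hm.le]
        norm_num

/-- The weighted oscillating integrand inherits bounds from the unweighted one. -/
lemma IntegralBoundOn.one_add_sq_rpow_mul {f : ℝ → ℂ} (hf : Continuous f) {S : Set ℝ}
    (hS : S.OrdConnected) {m K : ℝ} (hm : 0 < m) (hSm : ∀ r ∈ S, m ≤ r)
    (h : IntegralBoundOn f S K) (hK : 0 ≤ K) :
    IntegralBoundOn (fun r => (((1 + r ^ 2) ^ (-(1 / 4 : ℝ)) : ℝ) : ℂ) * f r) S (1 / √m * K) := by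
  intro p hp q hq hpq
  refine (norm_integral_weight_mul_le hpq hf hasDerivAt_one_add_sq_rpow ?_ ?_ (by positivity)
    (h.mono (hS.out hp hq) le_rfl)).trans
      (mul_le_mul_of_nonneg_right (one_add_sq_rpow_le hm (hSm p hp)) hK)
  · exact (by fun_prop : Continuous fun r : ℝ => 2 * r * (-(1 / 4))).mul
      ((by fun_prop : Continuous fun r : ℝ => 1 + r ^ 2).rpow_const
        fun r => Or.inl (by positivity))
  · intro r hr
    have hr0 : 0 ≤ r := hm.le.trans ((hSm p hp).trans hr.1)
    have := Real.rpow_nonneg (by positivity : (0 : ℝ) ≤ 1 + r ^ 2) (-(1 / 4 : ℝ) - 1)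
    nlinarith [mul_nonneg hr0 this]

lemma continuous_one_add_sq_rpow_mul {f : ℝ → ℂ} (hf : Continuous f) :
    Continuous (fun r : ℝ => (((1 + r ^ 2) ^ (-(1 / 4 : ℝ)) : ℝ) : ℂ) * f r) :=
  (Complex.continuous_ofReal.comp
    ((by fun_prop : Continuous fun r : ℝ => 1 + r ^ 2).rpow_const
      fun r => Or.inl (by positivity))).mul hf

/-- Trivial bound near the origin. -/
lemma integralBoundOn_one_add_sq_rpow_mul_Icc {f : ℝ → ℂ} (hf : ∀ r, ‖f r‖ = 1) (m : ℝ) :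
    IntegralBoundOn (fun r => (((1 + r ^ 2) ^ (-(1 / 4 : ℝ)) : ℝ) : ℂ) * f r)
      (Ici 0 ∩ Iic m) (2 * √m) := by
  intro p hp q hq hpq
  have hp0 : 0 ≤ p := hp.1
  have hqm : q ≤ m := hq.2
  calc _ ≤ ∫ r in p..q, r ^ (-(1 / 2) : ℝ) := by
        refine intervalIntegral.norm_integral_le_of_norm_le hpq
          (Filter.Eventually.of_forall fun r hr => ?_)
          (intervalIntegral.intervalIntegrable_rpow' (by norm_num))
        have hr0 : 0 < r := hp0.trans_lt hr.1
        rw [norm_mul, hf, mul_one, Complex.norm_real, Real.norm_eq_abs,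
          abs_of_nonneg (by positivity)]
        refine (one_add_sq_rpow_le hr0 le_rfl).trans (le_of_eq ?_)
        rw [Real.rpow_neg hr0.le, Real.sqrt_eq_rpow, one_div]
    _ = 2 * √q - 2 * √p := by
        rw [integral_rpow (Or.inl (by norm_num)), Real.sqrt_eq_rpow, Real.sqrt_eq_rpow]
        norm_num
        ring
    _ ≤ 2 * √m := by linarith [Real.sqrt_le_sqrt hqm, Real.sqrt_nonneg p]

/-- The weighted integrals with phase `a r + b r²` are `O(|a|^{-1/2})`, uniformly in `b`. -/
theorem integralBoundOn_one_add_sq_rpow_mul_quadOsc {a : ℝ} (ha : a ≠ 0) (b : ℝ) :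
    IntegralBoundOn (fun r => (((1 + r ^ 2) ^ (-(1 / 4 : ℝ)) : ℝ) : ℂ) * quadOsc a b r)
      (Ici 0) (30 / √|a|) := by
  have ha' : 0 < |a| := abs_pos.2 ha
  have hs : 0 < √|a| := Real.sqrt_pos.2 ha'
  have hss : √|a| * √|a| = |a| := Real.mul_self_sqrt ha'.le
  have hcE := continuous_quadOsc a b
  have hcont := continuous_one_add_sq_rpow_mul hcE
  have hm : 0 < 1 / |a| := by positivity
  have hmw : 1 / √(1 / |a|) = √|a| := by rw [Real.sqrt_div zero_le_one, Real.sqrt_one]; field_simp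
  have h₀ : IntegralBoundOn
      (fun r => (((1 + r ^ 2) ^ (-(1 / 4 : ℝ)) : ℝ) : ℂ) * quadOsc a b r)
      (Ici 0 ∩ Iic (1 / |a|)) (2 / √|a|) := by
    refine (integralBoundOn_one_add_sq_rpow_mul_Icc (norm_quadOsc a b) _).mono Subset.rfl
      (le_of_eq ?_)
    rw [Real.sqrt_div zero_le_one, Real.sqrt_one]; ring
  set S : Set ℝ := Ici 0 ∩ Ici (1 / |a|) with hSdef
  have hS : S.OrdConnected := ordConnected_Ici.inter ordConnected_Ici
  /- Away from the stationary point. -/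
  have hfar : ∀ T : Set ℝ, T.OrdConnected → T ⊆ S → (∀ r ∈ T, |a| / 2 ≤ |a + 2 * b * r|) →
      IntegralBoundOn (fun r => (((1 + r ^ 2) ^ (-(1 / 4 : ℝ)) : ℝ) : ℂ) * quadOsc a b r)
        T (8 / √|a|) := by
    intro T hT hTS h
    refine ((integralBoundOn_quadOsc_of_le_abs (by positivity) hT h).one_add_sq_rpow_mul hcE hT hm
      (fun r hr => (hTS hr).2) (by positivity)).mono Subset.rfl (le_of_eq ?_)
    rw [hmw]
    nth_rewrite 2 [← hss]
    field_simp
    norm_num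
  have h₁ : IntegralBoundOn
      (fun r => (((1 + r ^ 2) ^ (-(1 / 4 : ℝ)) : ℝ) : ℂ) * quadOsc a b r) S (28 / √|a|) := by
    by_cases hb : b = 0
    · refine (hfar S hS Subset.rfl fun r _ => ?_).mono Subset.rfl (by gcongr; norm_num)
      simp only [hb, mul_zero, zero_mul, add_zero]
      linarith
    have hb' : 0 < |b| := abs_pos.2 hb
    have habs : ∀ r ∈ S, |2 * b * r| = 2 * |b| * r := fun r hr => by
      rw [abs_mul, abs_mul, abs_two, abs_of_nonneg (show 0 ≤ r from hr.1)]
    have hlow : IntegralBoundOn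
        (fun r => (((1 + r ^ 2) ^ (-(1 / 4 : ℝ)) : ℝ) : ℂ) * quadOsc a b r)
        (S ∩ Iic (|a| / (4 * |b|))) (8 / √|a|) := by
      refine hfar _ (hS.inter ordConnected_Iic) inter_subset_left fun r hr => ?_
      have h1 : r * (4 * |b|) ≤ |a| := (le_div_iff₀ (by positivity)).1 hr.2
      have h2 := abs_sub_abs_le_abs_sub a (-(2 * b * r))
      rw [abs_neg, habs r hr.1, sub_neg_eq_add] at h2
      linarith
    have hhigh : IntegralBoundOn
        (fun r => (((1 + r ^ 2) ^ (-(1 / 4 : ℝ)) : ℝ) : ℂ) * quadOsc a b r)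
        ((S ∩ Ici (|a| / (4 * |b|))) ∩ Ici (|a| / |b|)) (8 / √|a|) := by
      refine hfar _ ((hS.inter ordConnected_Ici).inter ordConnected_Ici)
        (inter_subset_left.trans inter_subset_left) fun r hr => ?_
      have h1 : |a| ≤ r * |b| := (div_le_iff₀ hb').1 hr.2
      have h2 := abs_sub_abs_le_abs_sub (2 * b * r) (-a)
      rw [abs_neg, habs r hr.1.1, sub_neg_eq_add, add_comm (2 * b * r)] at h2
      linarith
    have hmid : IntegralBoundOn
        (fun r => (((1 + r ^ 2) ^ (-(1 / 4 : ℝ)) : ℝ) : ℂ) * quadOsc a b r)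
        ((S ∩ Ici (|a| / (4 * |b|))) ∩ Iic (|a| / |b|)) (12 / √|a|) := by
      refine (((integralBoundOn_quadOsc_univ a hb).mono (subset_univ _)
        le_rfl).one_add_sq_rpow_mul hcE ((hS.inter ordConnected_Ici).inter ordConnected_Iic)
        (by positivity) (fun r hr => hr.1.2) (by positivity)).mono Subset.rfl (le_of_eq ?_)
      have h4 : √(4 : ℝ) = 2 := by
        rw [show (4 : ℝ) = 2 ^ 2 by norm_num, Real.sqrt_sq zero_le_two]
      have hsb : 0 < √|b| := Real.sqrt_pos.2 hb'
      rw [Real.sqrt_div ha'.le, Real.sqrt_mul (by norm_num : (0 : ℝ) ≤ 4), h4]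
      field_simp
      norm_num
    refine (IntegralBoundOn.split' hcont hS (by positivity) (by positivity) hlow
      (IntegralBoundOn.split' hcont (hS.inter ordConnected_Ici) (by positivity) (by positivity)
        hmid hhigh)).mono Subset.rfl (le_of_eq ?_)
    ring
  refine (IntegralBoundOn.split' hcont ordConnected_Ici (by positivity) (by positivity) h₀ h₁).mono
    Subset.rfl (le_of_eq ?_)
  ring


/-- **Normalized oscillatory integral estimate.**
Let `B > 2`, `L > 0`. There is `c > 0` (depending only on `B`, `L`) such that for every
measurable `τ : (0,∞) → (0,1)` and all `s, s' ∈ (0, L]` with `s ≠ s'`, uniformly in every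
truncation `X > max (B/s) (B/s')`,
`|∫_{max(B/s, B/s')}^{X} (1 + r²)^{-1/4} e^{i(r(s-s') + (τ(s)-τ(s')) r²)} dr| ≤ c |s - s'|^{-1/2}`. -/
theorem normalized_oscillatory_integral_estimate
    (B L : ℝ) (hB : 2 < B) (hL : 0 < L) :
    ∃ c : ℝ, 0 < c ∧
      ∀ τ : ℝ → ℝ, Measurable τ → (∀ u : ℝ, 0 < u → τ u ∈ Set.Ioo 0 1) →
      ∀ s s' : ℝ, s ∈ Set.Ioc 0 L → s' ∈ Set.Ioc 0 L → s ≠ s' →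
      ∀ X : ℝ, max (B / s) (B / s') < X →
      ‖∫ r in (max (B / s) (B / s'))..X,
          (((1 + r ^ 2) ^ (-(1 / 4 : ℝ)) : ℝ) : ℂ) *
            Complex.exp (Complex.I *
              ((r * (s - s') + (τ s - τ s') * r ^ 2 : ℝ) : ℂ))‖
        ≤ c * |s - s'| ^ (-(1 / 2 : ℝ)) := by
  refine ⟨30, by norm_num, fun τ _ _ s s' hs hs' hne X hX => ?_⟩
  have hM : 0 ≤ max (B / s) (B / s') :=
    (div_nonneg (by linarith) hs.1.le).trans (le_max_left _ _)
  rw [Real.rpow_neg (abs_nonneg _), ← Real.sqrt_eq_rpow, ← div_eq_mul_inv]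
  exact integralBoundOn_one_add_sq_rpow_mul_quadOsc (sub_ne_zero.2 hne) (τ s - τ s')
    _ hM X (hM.trans hX.le) hX.le
end

section
/- Let Q > 0 and B > 2 be real numbers and let 0 < R₀ < R. There exists a constant c > 0, depending only on Q, B, R₀ and R, such that for every Lebesgue-measurable function t : (0,∞) → (0, 4/Q²) and all s, s' ∈ [R₀, R] with s ≠ s', the truncated oscillatory integrals satisfy, uniformly for every X > B/R₀: |∫_{B/R₀}^{X} (λ² + Q²/4)^{-1/4} · e^{i(λ(s−s') + (t(s)−t(s'))(λ² + Q²/4))} dλ| ≤ c (|s − s'|^{-1/2} + 1). -/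
open MeasureTheory Set

/-- First derivative test for a quadratic phase: an antitone nonnegative amplitude `g` gives an
oscillatory integral of size at most `5 g(α) / m` where the phase has derivative at least `m`. -/
theorem norm_integral_mul_exp_quadratic_le {g g' : ℝ → ℝ} {α β d τ q m : ℝ} (hαβ : α ≤ β)
    (hm : 0 < m) (hg : ∀ x ∈ Icc α β, HasDerivAt g (g' x) x) (hg'c : ContinuousOn g' (Icc α β))
    (hg' : ∀ x ∈ Icc α β, g' x ≤ 0) (hg0 : ∀ x ∈ Icc α β, 0 ≤ g x)
    (hψ : ∀ x ∈ Icc α β, m ≤ |d + 2 * τ * x|) :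
    ‖∫ l in α..β, (g l : ℂ) * Complex.exp (Complex.I *
      ((l * d + τ * (l ^ 2 + q) : ℝ) : ℂ))‖ ≤ 5 * g α / m := by
  have hα : α ∈ Icc α β := left_mem_Icc.2 hαβ
  have hβ : β ∈ Icc α β := right_mem_Icc.2 hαβ
  have hψ0 : ∀ x ∈ Icc α β, d + 2 * τ * x ≠ 0 := fun x hx h => by
    have := hψ x hx
    rw [h, abs_zero] at this
    linarith
  have hgc : ContinuousOn g (Icc α β) := fun x hx => (hg x hx).continuousAt.continuousWithinAt
  have hanti : ∀ x ∈ Icc α β, g x ≤ g α := by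
    have : AntitoneOn g (Icc α β) := by
      refine antitoneOn_of_hasDerivWithinAt_nonpos (convex_Icc α β) hgc
        (f' := g') (fun x hx => (hg x (interior_subset hx)).hasDerivWithinAt)
        (fun x hx => hg' x (interior_subset hx))
    exact fun x hx => this hα hx hx.1
  have hu : ∀ x ∈ Icc α β, HasDerivAt (fun x : ℝ => ((g x / (d + 2 * τ * x) : ℝ) : ℂ))
      (((g' x * (d + 2 * τ * x) - g x * (2 * τ)) / (d + 2 * τ * x) ^ 2 : ℝ) : ℂ) x := by
    intro x hx
    have h : HasDerivAt (fun x : ℝ => d + 2 * τ * x) (2 * τ) x := by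
      simpa using ((hasDerivAt_id x).const_mul (2 * τ)).const_add d
    exact ((hg x hx).div h (hψ0 x hx)).ofReal_comp
  have hv : ∀ x : ℝ, HasDerivAt (fun x : ℝ => -Complex.I * Complex.exp (Complex.I *
      ((x * d + τ * (x ^ 2 + q) : ℝ) : ℂ))) (((d + 2 * τ * x : ℝ) : ℂ) *
      Complex.exp (Complex.I * ((x * d + τ * (x ^ 2 + q) : ℝ) : ℂ))) x := by
    intro x
    have h : HasDerivAt (fun x : ℝ => x * d + τ * (x ^ 2 + q)) (d + 2 * τ * x) x := by
      have := ((hasDerivAt_id x).mul_const d).add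
        ((((hasDerivAt_id x).pow 2).add_const q).const_mul τ)
      exact this.congr_deriv (by simp; ring)
    have := ((h.ofReal_comp.const_mul Complex.I).cexp).const_mul (-Complex.I)
    refine this.congr_deriv ?_
    linear_combination (-(Complex.exp (Complex.I * ((x * d + τ * (x ^ 2 + q) : ℝ) : ℂ)) *
      ((d + 2 * τ * x : ℝ) : ℂ))) * Complex.I_sq
  have hψc : ContinuousOn (fun x : ℝ => d + 2 * τ * x) (Icc α β) := by fun_prop
  have hu'c : ContinuousOn (fun x : ℝ =>
      (g' x * (d + 2 * τ * x) - g x * (2 * τ)) / (d + 2 * τ * x) ^ 2) (Icc α β) :=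
    ((hg'c.mul hψc).sub (hgc.mul continuousOn_const)).div (hψc.pow 2)
      fun x hx => pow_ne_zero 2 (hψ0 x hx)
  have hIcc : uIcc α β = Icc α β := uIcc_of_le hαβ
  have hnorm : ∀ y : ℝ, ‖Complex.exp (Complex.I * (y : ℂ))‖ = 1 := fun y => by
    rw [mul_comm]; exact Complex.norm_exp_ofReal_mul_I y
  have key := intervalIntegral.integral_mul_deriv_eq_deriv_mul (a := α) (b := β)
    (fun x hx => hu x (hIcc ▸ hx)) (fun x _ => hv x)
    (ContinuousOn.intervalIntegrable (by
      rw [hIcc]; exact Complex.continuous_ofReal.comp_continuousOn hu'c))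
    (Continuous.intervalIntegrable (by fun_prop) _ _)
  have hcongr : ∫ l in α..β, (g l : ℂ) * Complex.exp (Complex.I *
      ((l * d + τ * (l ^ 2 + q) : ℝ) : ℂ)) = ∫ x in α..β, ((g x / (d + 2 * τ * x) : ℝ) : ℂ) *
      (((d + 2 * τ * x : ℝ) : ℂ) *
        Complex.exp (Complex.I * ((x * d + τ * (x ^ 2 + q) : ℝ) : ℂ))) := by
    refine intervalIntegral.integral_congr fun x hx => ?_
    have := hψ0 x (hIcc ▸ hx)
    rw [← mul_assoc, ← Complex.ofReal_mul, div_mul_cancel₀ _ this]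
  obtain ⟨σ, hσ, hσ1⟩ : ∃ σ : ℝ, |2 * τ| = σ * (2 * τ) ∧ |σ| ≤ 1 := by
    rcases abs_choice (2 * τ) with h | h
    · exact ⟨1, by rw [h, one_mul], by simp⟩
    · exact ⟨-1, by rw [h]; ring, by simp⟩
  have hinv : ∀ x ∈ Icc α β, |(d + 2 * τ * x)⁻¹| ≤ m⁻¹ := fun x hx => by
    rw [abs_inv]; exact inv_anti₀ hm (hψ x hx)
  have hH : ∀ x ∈ Icc α β, HasDerivAt (fun x => -(g x / m) - g α * σ * (d + 2 * τ * x)⁻¹)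
      (-(g' x / m) + g α * (|2 * τ| / (d + 2 * τ * x) ^ 2)) x := by
    intro x hx
    have h : HasDerivAt (fun x : ℝ => d + 2 * τ * x) (2 * τ) x := by
      simpa using ((hasDerivAt_id x).const_mul (2 * τ)).const_add d
    refine (((hg x hx).div_const m).neg.sub
      ((h.inv (hψ0 x hx)).const_mul (g α * σ))).congr_deriv ?_
    rw [hσ]
    ring
  have hHi : IntervalIntegrable (fun x => -(g' x / m) + g α * (|2 * τ| / (d + 2 * τ * x) ^ 2))
      volume α β := by
    refine ContinuousOn.intervalIntegrable ?_
    rw [hIcc]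
    exact (hg'c.div_const m).neg.add (continuousOn_const.mul
      (continuousOn_const.div (hψc.pow 2) fun x hx => pow_ne_zero 2 (hψ0 x hx)))
  have hrem := intervalIntegral.norm_integral_le_of_norm_le hαβ (μ := volume)
    (f := fun x : ℝ => (((g' x * (d + 2 * τ * x) - g x * (2 * τ)) / (d + 2 * τ * x) ^ 2 : ℝ) : ℂ) *
      (-Complex.I * Complex.exp (Complex.I * ((x * d + τ * (x ^ 2 + q) : ℝ) : ℂ))))
    (g := fun x => -(g' x / m) + g α * (|2 * τ| / (d + 2 * τ * x) ^ 2)) (by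
      refine Filter.Eventually.of_forall fun x hx => ?_
      have hx : x ∈ Icc α β := Ioc_subset_Icc_self hx
      have h0 := hψ0 x hx
      rw [norm_mul, norm_mul, hnorm, norm_neg, Complex.norm_I, mul_one, mul_one,
        Complex.norm_real, Real.norm_eq_abs]
      have hsplit : (g' x * (d + 2 * τ * x) - g x * (2 * τ)) / (d + 2 * τ * x) ^ 2
          = g' x * (d + 2 * τ * x)⁻¹ - g x * (2 * τ / (d + 2 * τ * x) ^ 2) := by
        field_simp
      rw [hsplit]
      refine (abs_sub _ _).trans (add_le_add ?_ ?_)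
      · rw [abs_mul, abs_of_nonpos (hg' x hx), ← neg_div, div_eq_mul_inv]
        exact mul_le_mul_of_nonneg_left (hinv x hx) (neg_nonneg.2 (hg' x hx))
      · rw [abs_mul, abs_of_nonneg (hg0 x hx), abs_div, abs_of_nonneg (sq_nonneg (d + 2 * τ * x))]
        exact mul_le_mul_of_nonneg_right (hanti x hx) (by positivity)) hHi
  rw [intervalIntegral.integral_eq_sub_of_hasDerivAt (fun x hx => hH x (hIcc ▸ hx)) hHi] at hrem
  have hbdry : ∀ x ∈ Icc α β, ‖((g x / (d + 2 * τ * x) : ℝ) : ℂ) * (-Complex.I *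
      Complex.exp (Complex.I * ((x * d + τ * (x ^ 2 + q) : ℝ) : ℂ)))‖ ≤ g α / m := by
    intro x hx
    rw [norm_mul, norm_mul, hnorm, norm_neg, Complex.norm_I, mul_one, mul_one,
      Complex.norm_real, Real.norm_eq_abs, abs_div, abs_of_nonneg (hg0 x hx)]
    exact div_le_div₀ (hg0 α hα) (hanti x hx) hm (hψ x hx)
  have hσb : ∀ x ∈ Icc α β, |g α * σ * (d + 2 * τ * x)⁻¹| ≤ g α / m := by
    intro x hx
    rw [abs_mul, abs_mul, abs_of_nonneg (hg0 α hα), div_eq_mul_inv]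
    exact mul_le_mul (mul_le_of_le_one_right (hg0 α hα) hσ1) (hinv x hx) (abs_nonneg _)
      (hg0 α hα)
  rw [hcongr, key]
  refine (norm_sub_le _ _).trans ((add_le_add ((norm_sub_le _ _).trans
    (add_le_add (hbdry β hβ) (hbdry α hα))) hrem).trans ?_)
  have h1 := abs_le.1 (hσb α hα)
  have h2 := abs_le.1 (hσb β hβ)
  have h3 : 0 ≤ g β / m := div_nonneg (hg0 β hβ) hm.le
  have h4 : 5 * g α / m = 5 * (g α / m) := by ring
  rw [h4]
  linarith [h1.1, h1.2, h2.1, h2.2]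

theorem norm_integral_le_add_of_split {f : ℝ → ℂ} (hf : Continuous f) {a p C₁ C₂ : ℝ}
    (hC₁ : 0 ≤ C₁) (hC₂ : 0 ≤ C₂)
    (h₁ : ∀ α β, a ≤ α → α ≤ β → β ≤ p → ‖∫ l in α..β, f l‖ ≤ C₁)
    (h₂ : ∀ α β, a ≤ α → p ≤ α → α ≤ β → ‖∫ l in α..β, f l‖ ≤ C₂)
    {α β : ℝ} (ha : a ≤ α) (hαβ : α ≤ β) : ‖∫ l in α..β, f l‖ ≤ C₁ + C₂ := by
  rcases le_total β p with h | h
  · linarith [h₁ α β ha hαβ h]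
  rcases le_total p α with h' | h'
  · linarith [h₂ α β ha h' hαβ]
  rw [← intervalIntegral.integral_add_adjacent_intervals (hf.intervalIntegrable α p)
    (hf.intervalIntegrable p β)]
  exact (norm_add_le _ _).trans (add_le_add (h₁ α p ha h' le_rfl) (h₂ p β (ha.trans h') le_rfl h))

theorem rpow_sq_add_le_rpow {q x : ℝ} (hq : 0 ≤ q) (hx : 0 < x) :
    (x ^ 2 + q) ^ (-(1 / 4 : ℝ)) ≤ x ^ (-(1 / 2 : ℝ)) := by
  have h : x ^ (-(1 / 2 : ℝ)) = (x ^ 2) ^ (-(1 / 4 : ℝ)) := by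
    rw [← Real.rpow_natCast, ← Real.rpow_mul hx.le]
    norm_num
  rw [h]
  exact Real.rpow_le_rpow_of_nonpos (by positivity) (by linarith) (by norm_num)

theorem norm_rpow_mul_exp_le {q x d τ y : ℝ} (hq : 0 ≤ q) (hy : 0 < y) (hyx : y ≤ x) :
    ‖(((x ^ 2 + q) ^ (-(1 / 4 : ℝ)) : ℝ) : ℂ) * Complex.exp (Complex.I *
      ((x * d + τ * (x ^ 2 + q) : ℝ) : ℂ))‖ ≤ y ^ (-(1 / 2 : ℝ)) := by
  rw [norm_mul, mul_comm Complex.I, Complex.norm_exp_ofReal_mul_I, mul_one, Complex.norm_real,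
    Real.norm_of_nonneg (by positivity)]
  exact (rpow_sq_add_le_rpow hq (hy.trans_le hyx)).trans
    (Real.rpow_le_rpow_of_nonpos hy hyx (by norm_num))

theorem norm_integral_rpow_mul_exp_le_of_le_abs {q d τ α β m y : ℝ} (hq : 0 < q) (hy : 0 < y)
    (hyα : y ≤ α) (hαβ : α ≤ β) (hm : 0 < m) (hψ : ∀ x ∈ Icc α β, m ≤ |d + 2 * τ * x|) :
    ‖∫ l in α..β, (((l ^ 2 + q) ^ (-(1 / 4 : ℝ)) : ℝ) : ℂ) * Complex.exp (Complex.I *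
      ((l * d + τ * (l ^ 2 + q) : ℝ) : ℂ))‖ ≤ 5 * y ^ (-(1 / 2 : ℝ)) / m := by
  have hα : 0 < α := hy.trans_le hyα
  have hpos : ∀ x : ℝ, 0 < x ^ 2 + q := fun x => by positivity
  have hderiv : ∀ x : ℝ, HasDerivAt (fun x : ℝ => (x ^ 2 + q) ^ (-(1 / 4 : ℝ)))
      (2 * x * (-(1 / 4 : ℝ)) * (x ^ 2 + q) ^ (-(1 / 4 : ℝ) - 1)) x := by
    intro x
    have h : HasDerivAt (fun x : ℝ => x ^ 2 + q) (2 * x) x := by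
      simpa using (hasDerivAt_pow 2 x).add_const q
    exact h.rpow_const (Or.inl (hpos x).ne')
  refine (norm_integral_mul_exp_quadratic_le (q := q) hαβ hm (fun x _ => hderiv x) ?_ ?_ ?_
    hψ).trans ?_
  · refine Continuous.continuousOn ?_
    exact (by fun_prop : Continuous fun x : ℝ => 2 * x * (-(1 / 4 : ℝ))).mul
      ((by fun_prop : Continuous fun x : ℝ => x ^ 2 + q).rpow_const
        fun x => Or.inl (hpos x).ne')
  · intro x hx
    have h0 : 0 ≤ x := hα.le.trans hx.1
    have h1 : 0 ≤ (x ^ 2 + q) ^ (-(1 / 4 : ℝ) - 1) := Real.rpow_nonneg (hpos x).le _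
    nlinarith [mul_nonneg h0 h1]
  · exact fun x _ => Real.rpow_nonneg (hpos x).le _
  · gcongr
    exact (rpow_sq_add_le_rpow hq.le hα).trans
      (Real.rpow_le_rpow_of_nonpos hy hyα (by norm_num))

/-- The integral near the origin, where the integrand has no useful oscillation. -/
theorem norm_integral_rpow_mul_exp_le_of_le {q d τ α β p : ℝ} (hq : 0 ≤ q) (hα : 0 < α)
    (hαβ : α ≤ β) (hβ : β ≤ p) :
    ‖∫ l in α..β, (((l ^ 2 + q) ^ (-(1 / 4 : ℝ)) : ℝ) : ℂ) * Complex.exp (Complex.I *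
      ((l * d + τ * (l ^ 2 + q) : ℝ) : ℂ))‖ ≤ 2 * p ^ (1 / 2 : ℝ) := by
  have h := intervalIntegral.norm_integral_le_of_norm_le hαβ (μ := volume)
    (f := fun l : ℝ => (((l ^ 2 + q) ^ (-(1 / 4 : ℝ)) : ℝ) : ℂ) * Complex.exp (Complex.I *
      ((l * d + τ * (l ^ 2 + q) : ℝ) : ℂ))) (g := fun l => l ^ (-(1 / 2 : ℝ)))
    (Filter.Eventually.of_forall fun x hx => norm_rpow_mul_exp_le hq (hα.trans hx.1) le_rfl)
    (intervalIntegral.intervalIntegrable_rpow' (by norm_num))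
  refine h.trans ?_
  rw [integral_rpow (Or.inl (by norm_num))]
  have h1 : β ^ (1 / 2 : ℝ) ≤ p ^ (1 / 2 : ℝ) :=
    Real.rpow_le_rpow (hα.le.trans hαβ) hβ (by norm_num)
  have h2 : 0 ≤ α ^ (1 / 2 : ℝ) := Real.rpow_nonneg hα.le _
  norm_num at h1 h2 ⊢
  linarith

theorem sq_rpow_neg_half {x : ℝ} (hx : 0 < x) : (x ^ (-(1 / 2 : ℝ))) ^ 2 = x⁻¹ := by
  rw [← Real.rpow_natCast, ← Real.rpow_mul hx.le, ← Real.rpow_neg_one]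
  norm_num

theorem norm_integral_rpow_mul_exp_le_of_stationary {q d τ L α β : ℝ} (hq : 0 < q) (hd : d ≠ 0)
    (hL : 0 < L) (hψ : ∀ x, |d + 2 * τ * x| = |d| * |L - x| / L) (hα : L / 2 ≤ α)
    (hαβ : α ≤ β) :
    ‖∫ l in α..β, (((l ^ 2 + q) ^ (-(1 / 4 : ℝ)) : ℝ) : ℂ) * Complex.exp (Complex.I *
      ((l * d + τ * (l ^ 2 + q) : ℝ) : ℂ))‖ ≤ 24 * |d| ^ (-(1 / 2 : ℝ)) := by
  have hD : 0 < |d| := abs_pos.2 hd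
  have hcont : Continuous fun l : ℝ => (((l ^ 2 + q) ^ (-(1 / 4 : ℝ)) : ℝ) : ℂ) *
      Complex.exp (Complex.I * ((l * d + τ * (l ^ 2 + q) : ℝ) : ℂ)) := by
    refine (Complex.continuous_ofReal.comp ?_).mul (by fun_prop)
    exact (by fun_prop : Continuous fun x : ℝ => x ^ 2 + q).rpow_const
      fun x => Or.inl (by positivity)
  set M := (L / 2) ^ (-(1 / 2 : ℝ)) with hMdef
  have hM2 : M ^ 2 = (L / 2)⁻¹ := sq_rpow_neg_half (by positivity)
  have hM : 0 < M := by positivity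
  set K := |d| ^ (-(1 / 2 : ℝ)) with hKdef
  have hK2 : K ^ 2 = |d|⁻¹ := sq_rpow_neg_half hD
  have hK : 0 < K := by positivity
  set δ := √(L / |d|) with hδdef
  have hδ : 0 < δ := by positivity
  have hδ2 : δ ^ 2 = L / |d| := Real.sq_sqrt (by positivity)
  have hMδ : M * δ ≤ 2 * K := by
    refine (sq_le_sq₀ (by positivity) (by positivity)).1 ?_
    rw [mul_pow, mul_pow, hM2, hδ2, hK2]
    have : (L / 2)⁻¹ * (L / |d|) = 2 * |d|⁻¹ := by field_simp
    rw [this]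
    have : 0 < |d|⁻¹ := by positivity
    linarith
  have hfar : 5 * M / (|d| * δ / L) = 5 * (M * δ) := by
    have : L = |d| * δ ^ 2 := by rw [hδ2]; field_simp
    rw [this]
    field_simp
  have hfarψ : ∀ x, δ ≤ |L - x| → |d| * δ / L ≤ |d + 2 * τ * x| := fun x hx => by
    rw [hψ]; gcongr
  have hnonstat : ∀ α β, L / 2 ≤ α → α ≤ β → (∀ x ∈ Icc α β, δ ≤ |L - x|) →
      ‖∫ l in α..β, (((l ^ 2 + q) ^ (-(1 / 4 : ℝ)) : ℝ) : ℂ) * Complex.exp (Complex.I *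
      ((l * d + τ * (l ^ 2 + q) : ℝ) : ℂ))‖ ≤ 10 * K := fun α β hα hαβ hx => by
    have := norm_integral_rpow_mul_exp_le_of_le_abs hq (by positivity) hα hαβ
      (m := |d| * δ / L) (by positivity) fun x h => hfarψ x (hx x h)
    rw [← hMdef, hfar] at this
    linarith
  have hmid : ∀ α β, L / 2 ≤ α → L - δ ≤ α → α ≤ β → ‖∫ l in α..β,
      (((l ^ 2 + q) ^ (-(1 / 4 : ℝ)) : ℝ) : ℂ) * Complex.exp (Complex.I *
      ((l * d + τ * (l ^ 2 + q) : ℝ) : ℂ))‖ ≤ 4 * K + 10 * K := by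
    intro α β hα hα' hαβ
    refine norm_integral_le_add_of_split hcont (a := α) (p := L + δ) (by positivity)
      (by positivity) (fun x y hx hxy hy => ?_) (fun x y hx hp hxy => ?_) le_rfl hαβ
    · have := intervalIntegral.norm_integral_le_of_norm_le_const (a := x) (b := y) (C := M)
        (f := fun l : ℝ => (((l ^ 2 + q) ^ (-(1 / 4 : ℝ)) : ℝ) : ℂ) * Complex.exp (Complex.I *
          ((l * d + τ * (l ^ 2 + q) : ℝ) : ℂ))) (fun l hl => by
          rw [uIoc_of_le hxy] at hl
          exact norm_rpow_mul_exp_le hq.le (by positivity) (by linarith [hl.1]))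
      rw [abs_of_nonneg (sub_nonneg.2 hxy)] at this
      have h2 : M * (y - x) ≤ M * (2 * δ) := mul_le_mul_of_nonneg_left (by linarith) hM.le
      linarith
    · refine hnonstat x y (hα.trans hx) hxy fun z hz => ?_
      rw [abs_sub_comm]
      exact (by linarith [hz.1] : δ ≤ z - L).trans (le_abs_self _)
  have := norm_integral_le_add_of_split hcont (a := L / 2) (p := L - δ) (C₁ := 10 * K)
    (C₂ := 4 * K + 10 * K) (by positivity) (by positivity)
    (fun x y hx hxy hy => hnonstat x y hx hxy fun z hz =>
      (by linarith [hz.2] : δ ≤ L - z).trans (le_abs_self _)) hmid hα hαβ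
  linarith

/-- The oscillatory integral with amplitude `(l² + q)^(-1/4)` and quadratic phase is bounded by the
linear coefficient of the phase alone, uniformly in the quadratic coefficient `τ`. -/
theorem norm_integral_rpow_mul_exp_le {q d α β : ℝ} (τ : ℝ) (hq : 0 < q) (hd : d ≠ 0)
    (hα : 0 < α) (hαβ : α ≤ β) :
    ‖∫ l in α..β, (((l ^ 2 + q) ^ (-(1 / 4 : ℝ)) : ℝ) : ℂ) * Complex.exp (Complex.I *
      ((l * d + τ * (l ^ 2 + q) : ℝ) : ℂ))‖ ≤ 36 * |d| ^ (-(1 / 2 : ℝ)) := by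
  have hD : 0 < |d| := abs_pos.2 hd
  have hcont : Continuous fun l : ℝ => (((l ^ 2 + q) ^ (-(1 / 4 : ℝ)) : ℝ) : ℂ) *
      Complex.exp (Complex.I * ((l * d + τ * (l ^ 2 + q) : ℝ) : ℂ)) := by
    refine (Complex.continuous_ofReal.comp ?_).mul (by fun_prop)
    exact (by fun_prop : Continuous fun x : ℝ => x ^ 2 + q).rpow_const
      fun x => Or.inl (by positivity)
  set K := |d| ^ (-(1 / 2 : ℝ)) with hKdef
  have hK2 : K ^ 2 = |d|⁻¹ := sq_rpow_neg_half hD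
  have hK : 0 < K := by positivity
  have hnear : (|d|⁻¹) ^ (1 / 2 : ℝ) = K := by
    rw [hKdef, Real.inv_rpow hD.le, Real.rpow_neg hD.le]
  have hamp : 5 * (|d|⁻¹) ^ (-(1 / 2 : ℝ)) / (|d| / 2) = 10 * K := by
    rw [Real.rpow_neg (by positivity), hnear]
    have : |d| = (K ^ 2)⁻¹ := by rw [hK2, inv_inv]
    rw [this]
    field_simp
    norm_num
  have hnonstat : ∀ x y, |d|⁻¹ ≤ x → x ≤ y → (∀ z ∈ Icc x y, |d| / 2 ≤ |d + 2 * τ * z|) →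
      ‖∫ l in x..y, (((l ^ 2 + q) ^ (-(1 / 4 : ℝ)) : ℝ) : ℂ) * Complex.exp (Complex.I *
      ((l * d + τ * (l ^ 2 + q) : ℝ) : ℂ))‖ ≤ 10 * K := fun x y hx hxy hψ =>
    hamp ▸ norm_integral_rpow_mul_exp_le_of_le_abs hq (by positivity) hx hxy (by positivity) hψ
  have hlarge : ∀ x y, α ≤ x → |d|⁻¹ ≤ x → x ≤ y → ‖∫ l in x..y,
      (((l ^ 2 + q) ^ (-(1 / 4 : ℝ)) : ℝ) : ℂ) * Complex.exp (Complex.I *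
      ((l * d + τ * (l ^ 2 + q) : ℝ) : ℂ))‖ ≤ 10 * K + 24 * K := by
    intro x y hαx hx hxy
    rcases le_or_gt 0 (d * τ) with hdτ | hdτ
    · refine (hnonstat x y hx hxy fun z hz => ?_).trans (by linarith)
      have hz0 : 0 ≤ z := hα.le.trans (hαx.trans hz.1)
      have : |d| ≤ |d + 2 * τ * z| :=
        sq_le_sq.1 (by nlinarith [mul_nonneg hdτ hz0, sq_nonneg (τ * z)])
      linarith
    · have hτ : τ ≠ 0 := by rintro rfl; simp at hdτ
      have hL : 0 < -d / (2 * τ) := by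
        have : -d / (2 * τ) = -(d * τ) / (2 * τ ^ 2) := by field_simp
        rw [this]
        have := neg_pos.2 hdτ
        positivity
      set L := -d / (2 * τ) with hLdef
      have hdL : d = -(2 * τ * L) := by rw [hLdef]; field_simp
      have hψ : ∀ x, |d + 2 * τ * x| = |d| * |L - x| / L := by
        intro x
        have : d + 2 * τ * x = d * (L - x) / L := by
          rw [eq_div_iff hL.ne']
          linear_combination x * hdL
        rw [this, abs_div, abs_mul, abs_of_pos hL]
      refine norm_integral_le_add_of_split hcont (a := x) (p := L / 2) (by positivity)
        (by positivity) (fun u v hu huv hv => ?_) (fun u v hu hp huv => ?_) le_rfl hxy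
      · refine hnonstat u v (hx.trans hu) huv fun z hz => ?_
        have h1 : L / 2 ≤ |L - z| := (by linarith [hz.2] : L / 2 ≤ L - z).trans (le_abs_self _)
        rw [hψ, le_div_iff₀ hL]
        nlinarith [mul_le_mul_of_nonneg_left h1 hD.le]
      · exact norm_integral_rpow_mul_exp_le_of_stationary hq hd hL hψ hp huv
  have := norm_integral_le_add_of_split hcont (a := α) (p := |d|⁻¹) (C₁ := 2 * K)
    (C₂ := 10 * K + 24 * K) (by positivity) (by positivity)
    (fun x y hx hxy hy => hnear ▸
      norm_integral_rpow_mul_exp_le_of_le hq.le (hα.trans_le hx) hxy hy) hlarge le_rfl hαβ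
  linarith

/-- **Oscillatory integral estimate with fixed lower limit `B/R₀` (used for `G₃`/`I₄`).**
Let `Q > 0`, `B > 2`, `0 < R₀ < R`. There is `c > 0` (depending only on `Q`, `B`, `R₀`, `R`)
such that for every measurable `t : (0,∞) → (0, 4/Q²)` and all `s, s' ∈ [R₀, R]` with
`s ≠ s'`, uniformly in every truncation `X > B/R₀`,
`|∫_{B/R₀}^{X} (λ² + Q²/4)^{-1/4} e^{i(λ(s-s') + (t(s)-t(s'))(λ² + Q²/4))} dλ|
  ≤ c (|s - s'|^{-1/2} + 1)`. -/
theorem oscillatory_integral_estimate_fixed_lower_limit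
    (Q B R₀ R : ℝ) (hQ : 0 < Q) (hB : 2 < B) (hR₀ : 0 < R₀) (hR : R₀ < R) :
    ∃ c : ℝ, 0 < c ∧
      ∀ t : ℝ → ℝ, Measurable t → (∀ u : ℝ, 0 < u → t u ∈ Set.Ioo 0 (4 / Q ^ 2)) →
      ∀ s s' : ℝ, s ∈ Set.Icc R₀ R → s' ∈ Set.Icc R₀ R → s ≠ s' →
      ∀ X : ℝ, B / R₀ < X →
      ‖∫ l in (B / R₀)..X,
          (((l ^ 2 + Q ^ 2 / 4) ^ (-(1 / 4 : ℝ)) : ℝ) : ℂ) *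
            Complex.exp (Complex.I *
              ((l * (s - s') + (t s - t s') * (l ^ 2 + Q ^ 2 / 4) : ℝ) : ℂ))‖
        ≤ c * (|s - s'| ^ (-(1 / 2 : ℝ)) + 1) := by
  refine ⟨36, by norm_num, fun t _ _ s s' _ _ hss X hX => ?_⟩
  have h := norm_integral_rpow_mul_exp_le (t s - t s') (q := Q ^ 2 / 4) (by positivity)
    (sub_ne_zero.2 hss) (div_pos (by linarith) hR₀ : 0 < B / R₀) hX.le
  linarith
end

section
/- Let m_𝔳 be a positive even integer and m_𝔷 a positive integer; set n = m_𝔳 + m_𝔷 + 1 and Q = m_𝔳/2 + m_𝔷. Define, for real λ ≠ 0, the Harish-Chandra c-function 𝐜(λ) = 2^{Q − 2iλ} · Γ(2iλ)/Γ((Q + 2iλ)/2) · Γ(n/2)/Γ((m_𝔳 + 4iλ + 2)/4), where Γ is the complex Gamma function. Then there exists a constant C ≥ 1, depending only on m_𝔳 and m_𝔷, such that for all real λ ≠ 0: (1/C) · λ²(1 + |λ|)^{n−3} ≤ |𝐜(λ)|^{-2} ≤ C · λ²(1 + |λ|)^{n−3}. -/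
open Complex

/-- The Harish-Chandra `𝐜`-function of a Damek-Ricci space with `dim 𝔳 = mv`,
`dim 𝔷 = mz`, `n = mv + mz + 1`, `Q = mv/2 + mz`:
`𝐜(λ) = 2^{Q-2iλ} Γ(2iλ)/Γ((Q+2iλ)/2) · Γ(n/2)/Γ((mv+4iλ+2)/4)`. -/
noncomputable def harishChandraC (mv mz : ℕ) (l : ℝ) : ℂ :=
  (2 : ℂ) ^ (((mv : ℂ) / 2 + (mz : ℂ)) - 2 * Complex.I * (l : ℂ)) *
    Complex.Gamma (2 * Complex.I * (l : ℂ)) /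
      Complex.Gamma ((((mv : ℂ) / 2 + (mz : ℂ)) + 2 * Complex.I * (l : ℂ)) / 2) *
    (Complex.Gamma (((mv : ℂ) + (mz : ℂ) + 1) / 2) /
      Complex.Gamma (((mv : ℂ) + 4 * Complex.I * (l : ℂ) + 2) / 4))

open Asymptotics Filter

/-- `|Γ(1/2 + iλ)|² = π / cosh(πλ)`. -/
lemma norm_sq_Gamma_half_add_mul_I (l : ℝ) :
    ‖Complex.Gamma (1 / 2 + l * I)‖ ^ 2 = Real.pi / Real.cosh (Real.pi * l) := by
  have h := Complex.Gamma_mul_Gamma_one_sub (1 / 2 + l * I)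
  have hc : (1 : ℂ) - (1 / 2 + l * I) = (starRingEnd ℂ) (1 / 2 + l * I) := by
    apply Complex.ext <;> simp
    norm_num
  have hs : Complex.sin (Real.pi * (1 / 2 + l * I)) = (Real.cosh (Real.pi * l) : ℝ) := by
    rw [show (Real.pi : ℂ) * (1 / 2 + l * I) = ((Real.pi * l : ℝ) : ℂ) * I + Real.pi / 2 by
      push_cast; ring, Complex.sin_add_pi_div_two, Complex.cos_mul_I, Complex.ofReal_cosh]
  rw [hc, Complex.Gamma_conj, hs, Complex.mul_conj'] at h
  exact_mod_cast h

/-- `|Γ(1 + iλ)|² = πλ / sinh(πλ)`. -/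
lemma norm_sq_Gamma_one_add_mul_I {l : ℝ} (hl : l ≠ 0) :
    ‖Complex.Gamma (1 + l * I)‖ ^ 2 = Real.pi * l / Real.sinh (Real.pi * l) := by
  have hlI : (l : ℂ) * I ≠ 0 := by simpa using hl
  have h := Complex.Gamma_mul_Gamma_one_sub (l * I)
  have hc : (1 : ℂ) - l * I = (starRingEnd ℂ) (1 + l * I) := by
    apply Complex.ext <;> simp
  have hs : Complex.sin (Real.pi * (l * I)) = (Real.sinh (Real.pi * l) : ℝ) * I := by
    rw [show (Real.pi : ℂ) * (l * I) = ((Real.pi * l : ℝ) : ℂ) * I by push_cast; ring,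
      Complex.sin_mul_I, Complex.ofReal_sinh]
  have hG : Complex.Gamma (1 + l * I) = l * I * Complex.Gamma (l * I) := by
    rw [add_comm, Complex.Gamma_add_one _ hlI]
  have key : Complex.Gamma (1 + l * I) * (starRingEnd ℂ) (Complex.Gamma (1 + l * I)) =
      ((Real.pi * l / Real.sinh (Real.pi * l) : ℝ) : ℂ) := by
    have hsh : (Real.sinh (Real.pi * l) : ℂ) ≠ 0 := by
      rw [Complex.ofReal_ne_zero, Ne, Real.sinh_eq_zero]
      exact mul_ne_zero Real.pi_ne_zero hl
    rw [← Complex.Gamma_conj, ← hc]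
    nth_rewrite 1 [hG]
    rw [mul_assoc, h, hs]
    push_cast at hsh ⊢
    field_simp
  rw [Complex.mul_conj'] at key
  exact_mod_cast key

lemma mul_cosh_div_sinh_bounds {t : ℝ} (ht : t ≠ 0) :
    (1 + |t|) / 2 ≤ t * Real.cosh t / Real.sinh t ∧
      t * Real.cosh t / Real.sinh t ≤ 1 + |t| := by
  wlog hpos : 0 < t generalizing t
  · have := this (neg_ne_zero.mpr ht)
      (neg_pos.mpr (lt_of_le_of_ne (not_lt.mp hpos) ht))
    simpa [neg_div_neg_eq] using this
  have hs : 0 < Real.sinh t := Real.sinh_pos_iff.mpr hpos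
  have hts : t ≤ Real.sinh t := Real.self_le_sinh_iff.mpr hpos.le
  have hsc : Real.sinh t ≤ Real.cosh t := (Real.sinh_lt_cosh t).le
  have hexp := Real.cosh_sub_sinh t
  have hexp1 : Real.exp (-t) ≤ 1 := Real.exp_le_one_iff.mpr (by linarith)
  have hstc : Real.sinh t ≤ t * Real.cosh t := by
    have hd : ∀ x : ℝ, HasDerivAt (fun x => x * Real.cosh x - Real.sinh x)
        (x * Real.sinh x) x := fun x => by
      have := ((hasDerivAt_id x).mul (Real.hasDerivAt_cosh x)).sub (Real.hasDerivAt_sinh x)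
      refine this.congr_deriv ?_
      simp
    have hm : Monotone (fun x => x * Real.cosh x - Real.sinh x) :=
      monotone_of_hasDerivAt_nonneg hd fun x => by
        rcases le_total 0 x with hx | hx
        · exact mul_nonneg hx (Real.sinh_nonneg_iff.mpr hx)
        · exact mul_nonneg_of_nonpos_of_nonpos hx (Real.sinh_nonpos_iff.mpr hx)
    have := hm hpos.le
    simp at this
    linarith
  rw [abs_of_pos hpos, le_div_iff₀ hs, div_le_iff₀ hs]
  constructor <;> nlinarith

lemma norm_sq_Gamma_one_add_isTheta :
    (fun l : ℝ => ‖Complex.Gamma (1 + l * I)‖ ^ 2) =Θ[𝓟 {l : ℝ | l ≠ 0}]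
      fun l => (1 + |l|) * ‖Complex.Gamma (1 / 2 + l * I)‖ ^ 2 := by
  have hpi := Real.pi_gt_three
  have hpi4 := Real.pi_le_four
  have hb : ∀ l : ℝ, l ≠ 0 →
      (1 + |l|) * ‖Complex.Gamma (1 / 2 + l * I)‖ ^ 2 ≤ 8 * ‖Complex.Gamma (1 + l * I)‖ ^ 2 ∧
      ‖Complex.Gamma (1 + l * I)‖ ^ 2 ≤
        4 * ((1 + |l|) * ‖Complex.Gamma (1 / 2 + l * I)‖ ^ 2) := by
    intro l hl
    have ht : Real.pi * l ≠ 0 := mul_ne_zero Real.pi_ne_zero hl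
    obtain ⟨h1, h2⟩ := mul_cosh_div_sinh_bounds ht
    have hs : Real.sinh (Real.pi * l) ≠ 0 := by rwa [Ne, Real.sinh_eq_zero]
    have hc := Real.cosh_pos (Real.pi * l)
    have hq : ‖Complex.Gamma (1 + l * I)‖ ^ 2 =
        (Real.pi * l * Real.cosh (Real.pi * l) / Real.sinh (Real.pi * l)) *
          (1 / Real.cosh (Real.pi * l)) := by
      rw [norm_sq_Gamma_one_add_mul_I hl]
      field_simp
    have hc' : 0 < 1 / Real.cosh (Real.pi * l) := by positivity
    rw [hq, norm_sq_Gamma_half_add_mul_I, div_eq_mul_one_div Real.pi]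
    rw [abs_mul, abs_of_pos Real.pi_pos] at h1 h2
    have hl0 := abs_nonneg l
    constructor
    · rw [← mul_assoc, ← mul_assoc]
      refine mul_le_mul_of_nonneg_right ?_ hc'.le
      nlinarith
    · rw [← mul_assoc, ← mul_assoc]
      refine mul_le_mul_of_nonneg_right ?_ hc'.le
      nlinarith
  refine ⟨isBigO_principal.2 ⟨4, fun l hl => ?_⟩, isBigO_principal.2 ⟨8, fun l hl => ?_⟩⟩
  · rw [Real.norm_of_nonneg (by positivity), Real.norm_of_nonneg (by positivity)]
    exact (hb l hl).2
  · rw [Real.norm_of_nonneg (by positivity), Real.norm_of_nonneg (by positivity)]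
    exact (hb l hl).1

lemma norm_sq_add_mul_I_isTheta {a : ℝ} (ha : 0 < a) (s : Set ℝ) :
    (fun l : ℝ => ‖(a : ℂ) + l * I‖ ^ 2) =Θ[𝓟 s] fun l => (1 + |l|) ^ 2 := by
  have hn : ∀ l : ℝ, ‖(a : ℂ) + l * I‖ ^ 2 = a ^ 2 + |l| ^ 2 := fun l => by
    rw [Complex.sq_norm, Complex.normSq_add_mul_I, sq_abs]
  simp only [hn]
  refine ⟨isBigO_principal.2 ⟨a ^ 2 + 1, fun l _ => ?_⟩,
    isBigO_principal.2 ⟨2 / a ^ 2 + 2, fun l _ => ?_⟩⟩ <;>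
  rw [Real.norm_of_nonneg (by positivity), Real.norm_of_nonneg (by positivity)] <;>
  have hl := abs_nonneg l
  · nlinarith [mul_nonneg (sq_nonneg a) hl, mul_nonneg (sq_nonneg a) (sq_nonneg |l|)]
  · have h1 : (2 / a ^ 2 + 2) * (a ^ 2 + |l| ^ 2) =
        2 + 2 * |l| ^ 2 + 2 * a ^ 2 + 2 / a ^ 2 * |l| ^ 2 := by
      field_simp
      ring
    rw [h1]
    have : 0 ≤ 2 / a ^ 2 * |l| ^ 2 := by positivity
    nlinarith [sq_nonneg (1 - |l|), sq_nonneg a]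

/-- On a vertical line with half-integral abscissa, `|Γ|²` grows like a power of `1 + |λ|`
relative to `|Γ(1/2 + iλ)|²`. -/
lemma norm_sq_Gamma_half_nat_isTheta (b : ℕ) :
    (fun l : ℝ => ‖Complex.Gamma (((b : ℂ) + 1) / 2 + l * I)‖ ^ 2) =Θ[𝓟 {l : ℝ | l ≠ 0}]
      fun l => (1 + |l|) ^ b * ‖Complex.Gamma (1 / 2 + l * I)‖ ^ 2 := by
  induction b using Nat.twoStepInduction with
  | zero => simpa using isTheta_refl _ _
  | one => simpa using norm_sq_Gamma_one_add_isTheta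
  | more b ih _ =>
    have ha : (0 : ℝ) < (b + 1) / 2 := by positivity
    have h := (norm_sq_add_mul_I_isTheta ha {l : ℝ | l ≠ 0}).mul ih
    refine (EventuallyEq.trans_isTheta (.of_eq (funext fun l => ?_)) h).trans_eventuallyEq
      (.of_eq (funext fun l => ?_))
    · rw [← mul_pow, ← norm_mul]
      push_cast
      rw [← Complex.Gamma_add_one _ ?_]
      · congr 3
        ring
      · intro h0
        have := congrArg Complex.re h0
        simp at this
        norm_cast at this
    · ring

lemma norm_sq_Gamma_two_mul_I_mul {l : ℝ} (hl : l ≠ 0) :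
    ‖Complex.Gamma (2 * I * l)‖ ^ 2 =
      ‖Complex.Gamma (1 + l * I)‖ ^ 2 * ‖Complex.Gamma (1 / 2 + l * I)‖ ^ 2 /
        (l ^ 2 * (4 * Real.pi)) := by
  have hlI : (l : ℂ) * I ≠ 0 := by simpa using hl
  have hG : Complex.Gamma (1 + l * I) = l * I * Complex.Gamma (l * I) := by
    rw [add_comm, Complex.Gamma_add_one _ hlI]
  have h := congrArg (fun z => ‖z‖ ^ 2) (Complex.Gamma_mul_Gamma_add_half (l * I))
  have h2 : ‖(2 : ℂ) ^ (1 - 2 * (l * I))‖ = 2 := by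
    have := Complex.norm_cpow_eq_rpow_re_of_pos (x := 2) (by norm_num) (1 - 2 * (l * I))
    simpa using this
  have h3 : ‖((Real.sqrt Real.pi : ℝ) : ℂ)‖ ^ 2 = Real.pi := by
    rw [Complex.norm_real, Real.norm_of_nonneg (Real.sqrt_nonneg _),
      Real.sq_sqrt Real.pi_pos.le]
  simp only [norm_mul, mul_pow, h2, h3] at h
  rw [hG, norm_mul, norm_mul, Complex.norm_I, Complex.norm_real, mul_one, mul_pow,
    Real.norm_eq_abs, sq_abs, mul_assoc (l ^ 2), add_comm (1 / 2 : ℂ), h,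
    show 2 * I * (l : ℂ) = 2 * (l * I) by ring]
  have := Real.pi_ne_zero
  field_simp
  norm_num

/-- **Plancherel density estimate.** Let `mv` be a positive even integer, `mz` a positive
integer, `n = mv + mz + 1`. There is `C ≥ 1`, depending only on `mv, mz`, such that for all
real `λ ≠ 0`: `(1/C) λ²(1+|λ|)^{n-3} ≤ |𝐜(λ)|⁻² ≤ C λ²(1+|λ|)^{n-3}`. -/
theorem plancherel_density_estimate
    (mv mz : ℕ) (hmv : 0 < mv) (hmv_even : Even mv) (hmz : 0 < mz) :
    ∃ C : ℝ, 1 ≤ C ∧ ∀ l : ℝ, l ≠ 0 →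
      (1 / C) * (l ^ 2 * (1 + |l|) ^ ((mv : ℝ) + (mz : ℝ) + 1 - 3)) ≤
          (‖harishChandraC mv mz l‖ ^ 2)⁻¹ ∧
        (‖harishChandraC mv mz l‖ ^ 2)⁻¹ ≤
          C * (l ^ 2 * (1 + |l|) ^ ((mv : ℝ) + (mz : ℝ) + 1 - 3)) := by
  obtain ⟨k, rfl⟩ := hmv_even
  obtain ⟨j, rfl⟩ : ∃ j, k = j + 1 := ⟨k - 1, by omega⟩
  obtain ⟨m, rfl⟩ : ∃ m, mz = m + 1 := ⟨mz - 1, by omega⟩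
  set G : ℕ → ℝ → ℝ := fun b l => ‖Complex.Gamma (((b : ℂ) + 1) / 2 + l * I)‖ ^ 2 with hGdef
  have hGpos : ∀ b l, 0 < G b l := fun b l => by
    have hre : 0 < (((b : ℂ) + 1) / 2 + l * I).re := by
      simp
      positivity
    have := norm_pos_iff.mpr (Complex.Gamma_ne_zero_of_re_pos hre)
    positivity
  have hG : ∀ b, G b =Θ[𝓟 {l : ℝ | l ≠ 0}] fun l => (1 + |l|) ^ b * G 0 l := fun b => by
    simpa [hGdef] using norm_sq_Gamma_half_nat_isTheta b
  set N : ℝ := ‖(2 : ℂ) ^ ((((j + 1 + (j + 1) : ℕ) : ℂ) / 2 + ((m + 1 : ℕ) : ℂ)))‖ ^ 2 *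
    ‖Complex.Gamma ((((j + 1 + (j + 1) : ℕ) : ℂ) + ((m + 1 : ℕ) : ℂ) + 1) / 2)‖ ^ 2 with hN
  have hNpos : 0 < N := by
    have hre : 0 < ((((j + 1 + (j + 1) : ℕ) : ℂ) + ((m + 1 : ℕ) : ℂ) + 1) / 2).re := by
      have : ((((j + 1 + (j + 1) : ℕ) : ℂ) + ((m + 1 : ℕ) : ℂ) + 1) / 2) =
        (((((j + 1 + (j + 1) : ℕ) : ℝ) + ((m + 1 : ℕ) : ℝ) + 1) / 2 : ℝ) : ℂ) := by
        push_cast; ring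
      rw [this, Complex.ofReal_re]
      positivity
    have h1 := norm_pos_iff.mpr (Complex.Gamma_ne_zero_of_re_pos hre)
    have h2 : 0 < ‖(2 : ℂ) ^ ((((j + 1 + (j + 1) : ℕ) : ℂ) / 2 + ((m + 1 : ℕ) : ℂ)))‖ := by
      rw [norm_pos_iff]
      simp [Complex.cpow_eq_zero_iff]
    positivity
  have hform : ∀ l : ℝ, l ≠ 0 → (‖harishChandraC (j + 1 + (j + 1)) (m + 1) l‖ ^ 2)⁻¹ =
      (4 * Real.pi / N) * (l ^ 2 * (G (j + m + 1) l * G (j + 1) l / (G 1 l * G 0 l))) := by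
    intro l hl
    have e1 : ((((j + 1 + (j + 1) : ℕ) : ℂ) / 2 + ((m + 1 : ℕ) : ℂ)) + 2 * I * l) / 2 =
        (((j + m + 1 : ℕ) : ℂ) + 1) / 2 + l * I := by
      push_cast; ring
    have e2 : (((j + 1 + (j + 1) : ℕ) : ℂ) + 4 * I * l + 2) / 4 =
        (((j + 1 : ℕ) : ℂ) + 1) / 2 + l * I := by
      push_cast; ring
    have e3 : ‖(2 : ℂ) ^ ((((j + 1 + (j + 1) : ℕ) : ℂ) / 2 + ((m + 1 : ℕ) : ℂ)) -
        2 * I * l)‖ =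
        ‖(2 : ℂ) ^ ((((j + 1 + (j + 1) : ℕ) : ℂ) / 2 + ((m + 1 : ℕ) : ℂ)))‖ := by
      have h := fun z => Complex.norm_cpow_eq_rpow_re_of_pos (x := 2) (by norm_num) z
      push_cast at h ⊢
      rw [h, h]
      simp
    have e4 : ‖Complex.Gamma (1 + l * I)‖ ^ 2 = G 1 l := by
      simp [hGdef]
    have e5 : ‖Complex.Gamma (1 / 2 + l * I)‖ ^ 2 = G 0 l := by
      simp [hGdef]
    have e6 := norm_sq_Gamma_two_mul_I_mul hl
    rw [e4, e5] at e6
    have h1 := hGpos (j + m + 1) l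
    have h2 := hGpos (j + 1) l
    have h3 := hGpos 1 l
    have h4 := hGpos 0 l
    have hpi := Real.pi_pos
    have : ‖harishChandraC (j + 1 + (j + 1)) (m + 1) l‖ ^ 2 =
        N * ((G 1 l * G 0 l) / (l ^ 2 * (4 * Real.pi))) / (G (j + m + 1) l * G (j + 1) l) := by
      rw [harishChandraC, e1, e2, norm_mul, norm_div, norm_div, norm_mul, e3, mul_pow, div_pow,
        div_pow, mul_pow, e6, hN]
      simp only [hGdef]
      ring
    rw [this]
    field_simp
  have hθ : (fun l => (‖harishChandraC (j + 1 + (j + 1)) (m + 1) l‖ ^ 2)⁻¹)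
      =Θ[𝓟 {l : ℝ | l ≠ 0}] fun l : ℝ => l ^ 2 *
        (1 + |l|) ^ ((((j + 1 + (j + 1) : ℕ) : ℝ) + ((m + 1 : ℕ) : ℝ) + 1 - 3)) := by
    have hK : 4 * Real.pi / N ≠ 0 := by positivity
    have h := ((isTheta_refl (fun l : ℝ => l ^ 2) (𝓟 {l : ℝ | l ≠ 0})).mul
      (((hG (j + m + 1)).mul (hG (j + 1))).div
        ((hG 1).mul (isTheta_refl (G 0) (𝓟 {l : ℝ | l ≠ 0}))))).const_mul_left hK
    refine (EventuallyEq.trans_isTheta ?_ h).trans_eventuallyEq ?_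
    · exact eventually_principal.2 hform
    · refine Eventually.of_forall fun l => ?_
      have hw : 0 < 1 + |l| := by positivity
      have h4 := hGpos 0 l
      have hexp : (((j + 1 + (j + 1) : ℕ) : ℝ) + ((m + 1 : ℕ) : ℝ) + 1 - 3) =
          ((j + m + 1 + j : ℕ) : ℝ) := by
        push_cast; ring
      simp only [hexp, Real.rpow_natCast]
      field_simp
      ring
  obtain ⟨A, hA⟩ := isBigO_principal.1 hθ.1
  obtain ⟨B, hB⟩ := isBigO_principal.1 hθ.2
  refine ⟨max 1 (max A B), le_max_left _ _, fun l hl => ?_⟩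
  have hC : 0 < max 1 (max A B) := lt_of_lt_of_le one_pos (le_max_left _ _)
  have hA := hA l hl
  have hB := hB l hl
  rw [Real.norm_of_nonneg (by positivity), Real.norm_of_nonneg (by positivity)] at hA hB
  constructor
  · rw [one_div, inv_mul_le_iff₀ hC]
    refine hB.trans (mul_le_mul_of_nonneg_right ?_ (by positivity))
    exact (le_max_right _ _).trans (le_max_right _ _)
  · refine hA.trans (mul_le_mul_of_nonneg_right ?_ (by positivity))
    exact (le_max_left _ _).trans (le_max_right _ _)
end

section
/- Let m_𝔳 be a positive even integer and m_𝔷 a positive integer; set n = m_𝔳 + m_𝔷 + 1 and Q = m_𝔳/2 + m_𝔷. Let A(s) = 2^{m_𝔳 + m_𝔷} (sinh(s/2))^{m_𝔳 + m_𝔷} (cosh(s/2))^{m_𝔷} and w(λ) = λ²(1 + λ)^{n−3}. For every R > 0 and B > 0 there exists c > 0, depending only on m_𝔳, m_𝔷, B and R, such that for every measurable function g : (0,∞) → ℂ: ∫_0^R ( ∫_0^{B/s} |g(λ)| w(λ) dλ ) A(s) ds ≤ c ( ∫_0^∞ (λ² + Q²/4)^{1/4} |g(λ)|² w(λ) dλ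 )^{1/2}. -/
open MeasureTheory
open scoped ENNReal NNReal

/-- The homogeneous dimension `Q = mv/2 + mz` of a Damek-Ricci space. -/
noncomputable def homDim (mv mz : ℕ) : ℝ := (mv : ℝ) / 2 + (mz : ℝ)

/-- The radial density `A(s) = 2^{mv+mz} sinh(s/2)^{mv+mz} cosh(s/2)^{mz}` of the left Haar
measure of a Damek-Ricci space with `dim 𝔳 = mv`, `dim 𝔷 = mz`. -/
noncomputable def radialDensity (mv mz : ℕ) (s : ℝ) : ℝ :=
  2 ^ (mv + mz) * Real.sinh (s / 2) ^ (mv + mz) * Real.cosh (s / 2) ^ mz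

/-- The Plancherel weight `w(λ) = λ²(1+λ)^{n-3}`, `n = mv + mz + 1`. -/
noncomputable def plancherelWeight (mv mz : ℕ) (l : ℝ) : ℝ :=
  l ^ 2 * (1 + l) ^ ((mv : ℝ) + (mz : ℝ) + 1 - 3)

/-- Cauchy-Schwarz inequality for a weighted lower Lebesgue integral. -/
theorem lintegral_mul_weight_le {α : Type*} [MeasurableSpace α] (μ : Measure α)
    {f w : α → ℝ≥0∞} (hf : AEMeasurable f μ) (hw : AEMeasurable w μ) :
    ∫⁻ a, f a * w a ∂μ ≤
      (∫⁻ a, f a ^ 2 * w a ∂μ) ^ ((1 : ℝ) / 2) * (∫⁻ a, w a ∂μ) ^ ((1 : ℝ) / 2) := by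
  have hsqrt (x : ℝ≥0∞) : x ^ ((1 : ℝ) / 2) * x ^ ((1 : ℝ) / 2) = x := by
    rw [← ENNReal.rpow_add_of_nonneg _ _ (by norm_num) (by norm_num)]
    norm_num
  have h := ENNReal.lintegral_mul_le_Lp_mul_Lq μ Real.HolderConjugate.two_two
    (hf.mul (hw.pow_const ((1 : ℝ) / 2))) (hw.pow_const ((1 : ℝ) / 2))
  have hsq (a : α) : f a * w a ^ ((1 : ℝ) / 2) * (f a * w a ^ ((1 : ℝ) / 2)) = f a ^ 2 * w a := by
    rw [mul_mul_mul_comm, hsqrt, pow_two]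
  have hprod (a : α) : f a * w a ^ ((1 : ℝ) / 2) * w a ^ ((1 : ℝ) / 2) = f a * w a := by
    rw [mul_assoc, hsqrt]
  simpa only [Pi.mul_apply, ENNReal.rpow_two, pow_two, hsq, hsqrt, hprod] using h

theorem sinh_le_mul_cosh {x : ℝ} (hx : 0 ≤ x) : Real.sinh x ≤ x * Real.cosh x := by
  have hmono : MonotoneOn (fun y : ℝ => y * Real.cosh y - Real.sinh y) (Set.Ici 0) := by
    refine monotoneOn_of_hasDerivWithinAt_nonneg (f' := fun y => y * Real.sinh y) (convex_Ici 0)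
      (by fun_prop) (fun y _ => ?_) (fun y hy => ?_)
    · have h := ((hasDerivAt_id y).mul (Real.hasDerivAt_cosh y)).sub (Real.hasDerivAt_sinh y)
      exact (h.congr_deriv (by simp)).hasDerivWithinAt
    · rw [interior_Ici] at hy
      exact mul_nonneg (le_of_lt hy) (Real.sinh_nonneg_iff.2 (le_of_lt hy))
  simpa using hmono (Set.mem_Ici.2 le_rfl) (Set.mem_Ici.2 hx) hx

theorem radialDensity_le (mv mz : ℕ) {s R : ℝ} (hs : 0 ≤ s) (hsR : s ≤ R) :
    radialDensity mv mz s ≤ Real.cosh (R / 2) ^ (mv + mz + mz) * s ^ (mv + mz) := by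
  have hsinh : 0 ≤ Real.sinh (s / 2) := Real.sinh_nonneg_iff.2 (by linarith)
  have hcosh : Real.cosh (s / 2) ≤ Real.cosh (R / 2) := by
    rw [Real.cosh_le_cosh, abs_of_nonneg (by linarith), abs_of_nonneg (by linarith)]
    linarith
  have hcosh0 := Real.cosh_pos (s / 2)
  calc radialDensity mv mz s
      ≤ 2 ^ (mv + mz) * (s / 2 * Real.cosh (R / 2)) ^ (mv + mz) * Real.cosh (R / 2) ^ mz := by
        unfold radialDensity
        gcongr
        exact (sinh_le_mul_cosh (by linarith)).trans (by gcongr)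
    _ = _ := by
        rw [← mul_pow, pow_add _ (mv + mz) mz, mul_right_comm, ← mul_pow]
        congr 2
        ring

theorem plancherelWeight_le {mv mz : ℕ} (hm : 2 ≤ mv + mz) {l M : ℝ} (hl : 0 ≤ l)
    (hlM : 1 + l ≤ M) : plancherelWeight mv mz l ≤ M ^ (mv + mz) := by
  obtain ⟨k, hk⟩ := Nat.exists_eq_add_of_le hm
  have hexp : (mv : ℝ) + mz + 1 - 3 = k := by
    have : (mv : ℝ) + mz = 2 + k := by exact_mod_cast hk
    linarith
  rw [plancherelWeight, hexp, Real.rpow_natCast, hk, pow_add]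
  gcongr
  linarith

theorem lintegral_plancherelWeight_le {mv mz : ℕ} (hm : 2 ≤ mv + mz) {s R B : ℝ} (hs : 0 < s)
    (hsR : s ≤ R) (hB : 0 < B) :
    ∫⁻ l in Set.Ioc (0 : ℝ) (B / s), ENNReal.ofReal (plancherelWeight mv mz l) ≤
      ENNReal.ofReal (((R + B) / s) ^ (mv + mz + 1)) := by
  have hRs : 1 ≤ R / s := (one_le_div hs).2 hsR
  have hM : 0 ≤ (R + B) / s := by have := hs.trans_le hsR; positivity
  calc _ ≤ ∫⁻ _ in Set.Ioc (0 : ℝ) (B / s), ENNReal.ofReal (((R + B) / s) ^ (mv + mz)) := by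
        refine setLIntegral_mono measurable_const fun l hl => ENNReal.ofReal_le_ofReal ?_
        refine plancherelWeight_le hm hl.1.le ?_
        rw [add_div]
        linarith [hl.2]
    _ = ENNReal.ofReal (((R + B) / s) ^ (mv + mz) * (B / s)) := by
        rw [setLIntegral_const, Real.volume_Ioc, sub_zero, ENNReal.ofReal_mul (by positivity)]
    _ ≤ _ := by
        rw [pow_succ]
        gcongr
        linarith

/-- The bound for `A(s)² ∫_0^{B/s} w` on `(0, R]`. -/
noncomputable def densityBound (mv mz : ℕ) (R B : ℝ) : ℝ :=
  Real.cosh (R / 2) ^ (2 * (mv + mz + mz)) * (R + B) ^ (mv + mz + 1) * R ^ (mv + mz - 1)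

theorem densityBound_pos (mv mz : ℕ) {R B : ℝ} (hR : 0 < R) (hB : 0 < B) :
    0 < densityBound mv mz R B := by
  have := Real.cosh_pos (R / 2)
  unfold densityBound
  positivity

theorem sqrt_lintegral_plancherelWeight_mul_radialDensity_le {mv mz : ℕ} (hm : 2 ≤ mv + mz)
    {s R B : ℝ} (hs : 0 < s) (hsR : s ≤ R) (hB : 0 < B) :
    (∫⁻ l in Set.Ioc (0 : ℝ) (B / s), ENNReal.ofReal (plancherelWeight mv mz l)) ^ ((1 : ℝ) / 2) *
        ENNReal.ofReal (radialDensity mv mz s) ≤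
      ENNReal.ofReal √(densityBound mv mz R B) := by
  have hR := hs.trans_le hsR
  have hcosh := Real.cosh_pos (R / 2)
  calc _ ≤ ENNReal.ofReal (((R + B) / s) ^ (mv + mz + 1)) ^ ((1 : ℝ) / 2) *
          ENNReal.ofReal (Real.cosh (R / 2) ^ (mv + mz + mz) * s ^ (mv + mz)) := by
        gcongr
        · exact lintegral_plancherelWeight_le hm hs hsR hB
        · exact radialDensity_le mv mz hs.le hsR
    _ = ENNReal.ofReal (√(((R + B) / s) ^ (mv + mz + 1)) *
          (Real.cosh (R / 2) ^ (mv + mz + mz) * s ^ (mv + mz))) := by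
        rw [ENNReal.ofReal_rpow_of_nonneg (by positivity) (by norm_num), ← Real.sqrt_eq_rpow,
          ENNReal.ofReal_mul (Real.sqrt_nonneg _)]
    _ ≤ _ := by
        refine ENNReal.ofReal_le_ofReal (Real.le_sqrt_of_sq_le ?_)
        rw [mul_pow, Real.sq_sqrt (by positivity), densityBound]
        obtain ⟨k, hk⟩ := Nat.exists_eq_add_of_le' (one_le_two.trans hm)
        calc _ = Real.cosh (R / 2) ^ (2 * (mv + mz + mz)) * (R + B) ^ (mv + mz + 1) *
              s ^ (mv + mz - 1) := by
              rw [pow_mul', div_pow, mul_pow]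
              have : (s ^ (mv + mz)) ^ 2 = s ^ (mv + mz + 1) * s ^ (mv + mz - 1) := by
                rw [hk, Nat.add_sub_cancel]; ring
              rw [this]
              field_simp
          _ ≤ _ := by gcongr

theorem measurable_plancherelWeight (mv mz : ℕ) : Measurable (plancherelWeight mv mz) := by
  unfold plancherelWeight
  fun_prop

/-- **L¹ estimate for the low-frequency part `T₁`.**
Let `mv` be a positive even integer, `mz` a positive integer, `R > 0`, `B > 0`. There is
`c > 0` (depending only on `mv`, `mz`, `B`, `R`) such that for every measurable
`g : (0,∞) → ℂ`:
`∫_0^R (∫_0^{B/s} |g(λ)| w(λ) dλ) A(s) ds ≤ c (∫_0^∞ (λ²+Q²/4)^{1/4} |g(λ)|² w(λ) dλ)^{1/2}`. -/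
theorem low_frequency_L1_estimate
    (mv mz : ℕ) (hmv : 0 < mv) (hmv_even : Even mv) (hmz : 0 < mz)
    (R B : ℝ) (hR : 0 < R) (hB : 0 < B) :
    ∃ c : ℝ, 0 < c ∧ ∀ g : ℝ → ℂ, Measurable g →
      (∫⁻ s in Set.Ioc (0:ℝ) R,
          (∫⁻ l in Set.Ioc (0:ℝ) (B / s),
              (‖g l‖₊ : ℝ≥0∞) * ENNReal.ofReal (plancherelWeight mv mz l)) *
            ENNReal.ofReal (radialDensity mv mz s))
        ≤ ENNReal.ofReal c *
            (∫⁻ l in Set.Ioi (0:ℝ),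
                ENNReal.ofReal ((l ^ 2 + homDim mv mz ^ 2 / 4) ^ ((1:ℝ)/4)) *
                  (‖g l‖₊ : ℝ≥0∞) ^ 2 * ENNReal.ofReal (plancherelWeight mv mz l))
              ^ ((1:ℝ)/2) := by
  have hm : 2 ≤ mv + mz := by omega
  set q : ℝ := (homDim mv mz ^ 2 / 4) ^ ((1 : ℝ) / 4) with hq_def
  have hQ : 0 < homDim mv mz := by unfold homDim; positivity
  have hq : 0 < q := by positivity
  have hD := densityBound_pos mv mz hR hB
  refine ⟨√q⁻¹ * √(densityBound mv mz R B) * R, by positivity, fun g hg => ?_⟩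
  have hw : Measurable fun l => ENNReal.ofReal (plancherelWeight mv mz l) :=
    (measurable_plancherelWeight mv mz).ennreal_ofReal
  set I : ℝ≥0∞ := ∫⁻ l in Set.Ioi (0 : ℝ),
    ENNReal.ofReal ((l ^ 2 + homDim mv mz ^ 2 / 4) ^ ((1 : ℝ) / 4)) *
      (‖g l‖₊ : ℝ≥0∞) ^ 2 * ENNReal.ofReal (plancherelWeight mv mz l) with hI
  have hmass (b : ℝ) : ∫⁻ l in Set.Ioc 0 b,
      (‖g l‖₊ : ℝ≥0∞) ^ 2 * ENNReal.ofReal (plancherelWeight mv mz l) ≤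
        ENNReal.ofReal q⁻¹ * I := by
    refine (lintegral_mono_set Set.Ioc_subset_Ioi_self).trans ?_
    rw [hI, ← lintegral_const_mul' _ _ ENNReal.ofReal_ne_top]
    refine lintegral_mono fun l => ?_
    rw [← mul_assoc, ← mul_assoc, ← ENNReal.ofReal_mul (by positivity)]
    gcongr
    refine le_mul_of_one_le_left' (ENNReal.one_le_ofReal.2 ?_)
    rw [inv_mul_eq_div, one_le_div hq, hq_def]
    gcongr
    exact le_add_of_nonneg_left (sq_nonneg l)
  calc _ ≤ ∫⁻ _ in Set.Ioc (0 : ℝ) R, (ENNReal.ofReal q⁻¹ * I) ^ ((1 : ℝ) / 2) *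
          ENNReal.ofReal √(densityBound mv mz R B) := by
        refine setLIntegral_mono measurable_const fun s hs => ?_
        refine (mul_le_mul_left (lintegral_mul_weight_le _
          hg.nnnorm.coe_nnreal_ennreal.aemeasurable hw.aemeasurable) _).trans ?_
        rw [mul_assoc]
        gcongr
        · exact hmass _
        · exact sqrt_lintegral_plancherelWeight_mul_radialDensity_le hm hs.1 hs.2 hB
    _ = _ := by
        rw [setLIntegral_const, Real.volume_Ioc, sub_zero,
          ENNReal.mul_rpow_of_nonneg _ _ (by norm_num : (0 : ℝ) ≤ 1 / 2),
          ENNReal.ofReal_rpow_of_nonneg (by positivity) (by norm_num), ← Real.sqrt_eq_rpow,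
          ENNReal.ofReal_mul (by positivity), ENNReal.ofReal_mul (by positivity)]
        ring
end

section
/- Let m_𝔳 be a positive even integer and m_𝔷 a positive integer; set Q = m_𝔳/2 + m_𝔷. Let A(s) = 2^{m_𝔳 + m_𝔷} (sinh(s/2))^{m_𝔳 + m_𝔷} (cosh(s/2))^{m_𝔷}. Let B > 2 and R > 0. Then there exists C > 0, depending only on m_𝔳, m_𝔷, B and R, such that for every Lebesgue-measurable t : (0,∞) → (0, 4/Q²) and every measurable θ : (0, R] → ℂ with |θ(s)| = 1 for all s: ∫_{B/R}^∞ (λ² + Q²/4)^{-1/4} | ∫_{B/λ}^{R} θ(s) A(s)^{1/2} e^{i(λ s + t(s)(λ² + Q²/4))} ds |² dλ ≤ C. -/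
open MeasureTheory
open scoped ENNReal NNReal

theorem norm_integral_le_add_of_split_s7 {g : ℝ → ℂ} {a b c K₁ K₂ : ℝ} (hab : a ≤ b)
    (hg : IntervalIntegrable g volume a b) (hK₁ : 0 ≤ K₁) (hK₂ : 0 ≤ K₂)
    (h₁ : ∀ p q, a ≤ p → p ≤ q → q ≤ b → q ≤ c → ‖∫ l in p..q, g l‖ ≤ K₁)
    (h₂ : ∀ p q, a ≤ p → p ≤ q → q ≤ b → c ≤ p → ‖∫ l in p..q, g l‖ ≤ K₂) :
    ‖∫ l in a..b, g l‖ ≤ K₁ + K₂ := by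
  rcases le_total c a with hca | hac
  · linarith [h₂ a b le_rfl hab le_rfl hca]
  rcases le_total b c with hbc | hcb
  · linarith [h₁ a b le_rfl hab le_rfl hbc]
  have hac' : IntervalIntegrable g volume a c :=
    hg.mono_set (by rw [Set.uIcc_of_le hac, Set.uIcc_of_le hab]; exact Set.Icc_subset_Icc_right hcb)
  have hcb' : IntervalIntegrable g volume c b :=
    hg.mono_set (by rw [Set.uIcc_of_le hcb, Set.uIcc_of_le hab]; exact Set.Icc_subset_Icc_left hac)
  rw [← intervalIntegral.integral_add_adjacent_intervals hac' hcb']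
  exact (norm_add_le _ _).trans
    (add_le_add (h₁ a c le_rfl hac hcb le_rfl) (h₂ c b hac hcb le_rfl le_rfl))

/-- The oscillating factor `e^{i(xλ + τλ²)}`. -/
noncomputable def quadPhase (x τ l : ℝ) : ℂ :=
  Complex.exp (Complex.I * ((x * l + τ * l ^ 2 : ℝ) : ℂ))

theorem norm_quadPhase (x τ l : ℝ) : ‖quadPhase x τ l‖ = 1 := by
  rw [quadPhase, mul_comm, Complex.norm_exp_ofReal_mul_I]

theorem continuous_quadPhase (x τ : ℝ) : Continuous (quadPhase x τ) := by
  unfold quadPhase; fun_prop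

theorem hasDerivAt_quadPhase (x τ l : ℝ) :
    HasDerivAt (quadPhase x τ) (quadPhase x τ l * (Complex.I * ((x + 2 * τ * l : ℝ) : ℂ))) l := by
  have h : HasDerivAt (fun l : ℝ => x * l + τ * l ^ 2) (x + 2 * τ * l) l := by
    have := ((hasDerivAt_id l).const_mul x).add (((hasDerivAt_id l).pow 2).const_mul τ)
    refine this.congr_deriv ?_
    simp; ring
  exact (h.ofReal_comp.const_mul Complex.I).cexp

theorem norm_integral_quadPhase_le_of_le_abs_deriv {w w' : ℝ → ℝ} {x τ m p q : ℝ}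
    (hpq : p ≤ q) (hm : 0 < m)
    (hw : ∀ l ∈ Set.Icc p q, HasDerivAt w (w' l) l) (hw'c : ContinuousOn w' (Set.Icc p q))
    (hw' : ∀ l ∈ Set.Icc p q, w' l ≤ 0) (hw0 : ∀ l ∈ Set.Icc p q, 0 ≤ w l)
    (hφ : ∀ l ∈ Set.Icc p q, m ≤ |x + 2 * τ * l|) :
    ‖∫ l in p..q, (w l : ℂ) * quadPhase x τ l‖ ≤ 5 * w p / m := by
  have hφ0 : ∀ l ∈ Set.Icc p q, x + 2 * τ * l ≠ 0 := fun l hl =>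
    abs_pos.1 (hm.trans_le (hφ l hl))
  have hwc : ContinuousOn w (Set.Icc p q) := fun l hl => (hw l hl).continuousAt.continuousWithinAt
  have hp : p ∈ Set.Icc p q := ⟨le_rfl, hpq⟩
  have hq : q ∈ Set.Icc p q := ⟨hpq, le_rfl⟩
  have hanti : ∀ l ∈ Set.Icc p q, w l ≤ w p := fun l hl =>
    antitoneOn_of_deriv_nonpos (convex_Icc p q) hwc
      (fun y hy => (hw y (interior_subset hy)).differentiableAt.differentiableWithinAt)
      (fun y hy => by
        rw [(hw y (interior_subset hy)).deriv]; exact hw' y (interior_subset hy)) hp hl hl.1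
  set u : ℝ → ℝ := fun l => w l / (x + 2 * τ * l) with hu_def
  set u' : ℝ → ℝ := fun l =>
    (w' l * (x + 2 * τ * l) - w l * (2 * τ)) / (x + 2 * τ * l) ^ 2 with hu'_def
  have hlin : ∀ l : ℝ, HasDerivAt (fun l : ℝ => x + 2 * τ * l) (2 * τ) l := fun l => by
    simpa using ((hasDerivAt_id l).const_mul (2 * τ)).const_add x
  have hu : ∀ l ∈ Set.Icc p q, HasDerivAt u (u' l) l := fun l hl =>
    (hw l hl).div (hlin l) (hφ0 l hl)
  have hu'c : ContinuousOn u' (Set.Icc p q) := by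
    refine ContinuousOn.div ?_ (by fun_prop) fun l hl => pow_ne_zero 2 (hφ0 l hl)
    exact (hw'c.mul (by fun_prop)).sub (hwc.mul (by fun_prop))
  have hec : ContinuousOn (quadPhase x τ) (Set.Icc p q) := (continuous_quadPhase x τ).continuousOn
  have hF : ∀ l ∈ Set.uIcc p q, HasDerivAt (fun l => -Complex.I * ((u l : ℂ) * quadPhase x τ l))
      ((w l : ℂ) * quadPhase x τ l + -Complex.I * ((u' l : ℂ) * quadPhase x τ l)) l := by
    intro l hl
    rw [Set.uIcc_of_le hpq] at hl
    have := (((hu l hl).ofReal_comp).mul (hasDerivAt_quadPhase x τ l)).const_mul (-Complex.I)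
    refine this.congr_deriv ?_
    have h0 : (x + 2 * τ * l : ℂ) ≠ 0 := by exact_mod_cast hφ0 l hl
    simp only [hu_def]
    push_cast
    field_simp
    ring_nf
    simp [Complex.I_sq]
  have hi1 : IntervalIntegrable (fun l => (w l : ℂ) * quadPhase x τ l) volume p q := by
    apply ContinuousOn.intervalIntegrable
    rw [Set.uIcc_of_le hpq]
    exact (Complex.continuous_ofReal.comp_continuousOn hwc).mul hec
  have hi2 : IntervalIntegrable (fun l => -Complex.I * ((u' l : ℂ) * quadPhase x τ l))
      volume p q := by
    apply ContinuousOn.intervalIntegrable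
    rw [Set.uIcc_of_le hpq]
    exact continuousOn_const.mul ((Complex.continuous_ofReal.comp_continuousOn hu'c).mul hec)
  have hFTC := intervalIntegral.integral_eq_sub_of_hasDerivAt hF (hi1.add hi2)
  rw [intervalIntegral.integral_add hi1 hi2] at hFTC
  have hub : ∀ l ∈ Set.Icc p q, |u l| ≤ w p / m := fun l hl => by
    rw [hu_def, abs_div, abs_of_nonneg (hw0 l hl)]
    exact div_le_div₀ (hw0 p hp) (hanti l hl) hm (hφ l hl)
  obtain ⟨ε, hε1, hετ⟩ : ∃ ε : ℝ, |ε| ≤ 1 ∧ ε * τ = |τ| := by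
    rcases le_total 0 τ with h | h
    · exact ⟨1, by simp, by rw [abs_of_nonneg h, one_mul]⟩
    · exact ⟨-1, by simp, by rw [abs_of_nonpos h]; ring⟩
  have hH : ∀ l ∈ Set.uIcc p q, HasDerivAt (fun l => -(w l / m) - w p * ε / (x + 2 * τ * l))
      (-(w' l / m) + w p * (2 * |τ|) / (x + 2 * τ * l) ^ 2) l := by
    intro l hl
    rw [Set.uIcc_of_le hpq] at hl
    have := (((hw l hl).div_const m).neg).sub
      ((hasDerivAt_const l (w p * ε)).div (hlin l) (hφ0 l hl))
    refine this.congr_deriv ?_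
    rw [← hετ]; ring
  have hHi : IntervalIntegrable (fun l => -(w' l / m) + w p * (2 * |τ|) / (x + 2 * τ * l) ^ 2)
      volume p q := by
    apply ContinuousOn.intervalIntegrable
    rw [Set.uIcc_of_le hpq]
    refine (hw'c.div_const m).neg.add (ContinuousOn.div (by fun_prop) (by fun_prop) ?_)
    exact fun l hl => pow_ne_zero 2 (hφ0 l hl)
  have hbound : ‖∫ l in p..q, -Complex.I * ((u' l : ℂ) * quadPhase x τ l)‖ ≤ 3 * (w p / m) := by
    refine (intervalIntegral.norm_integral_le_of_norm_le hpq (Filter.Eventually.of_forall ?_)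
      hHi).trans ?_
    · intro l hl
      have hl := Set.Ioc_subset_Icc_self hl
      rw [norm_mul, norm_mul, norm_quadPhase, norm_neg, Complex.norm_I, Complex.norm_real,
        Real.norm_eq_abs, one_mul, mul_one, hu'_def]
      have hpos := hm.trans_le (hφ l hl)
      have e : (w' l * (x + 2 * τ * l) - w l * (2 * τ)) / (x + 2 * τ * l) ^ 2
          = w' l / (x + 2 * τ * l) - w l * (2 * τ) / (x + 2 * τ * l) ^ 2 := by
        have := hφ0 l hl
        field_simp
      simp only [e]
      refine (abs_sub _ _).trans (add_le_add ?_ ?_)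
      · rw [abs_div, abs_of_nonpos (hw' l hl), ← neg_div]
        exact div_le_div_of_nonneg_left (neg_nonneg.2 (hw' l hl)) hm (hφ l hl)
      · rw [abs_div, abs_of_nonneg (sq_nonneg (x + 2 * τ * l)), abs_mul,
          abs_of_nonneg (hw0 l hl), abs_mul, abs_two]
        gcongr
        exact hanti l hl
    · rw [intervalIntegral.integral_eq_sub_of_hasDerivAt hH hHi]
      have hb : ∀ l ∈ Set.Icc p q, |w p * ε / (x + 2 * τ * l)| ≤ w p / m := fun l hl => by
        rw [abs_div, abs_mul, abs_of_nonneg (hw0 p hp)]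
        refine div_le_div₀ (hw0 p hp) ?_ hm (hφ l hl)
        exact mul_le_of_le_one_right (hw0 p hp) hε1
      have h1 := abs_le.1 (hb p hp)
      have h2 := abs_le.1 (hb q hq)
      have h3 : 0 ≤ w q / m := div_nonneg (hw0 q hq) hm.le
      linarith [h1.2, h2.1]
  have hn : ∀ l ∈ Set.Icc p q, ‖-Complex.I * ((u l : ℂ) * quadPhase x τ l)‖ ≤ w p / m := by
    intro l hl
    rw [norm_mul, norm_mul, norm_quadPhase, norm_neg, Complex.norm_I, Complex.norm_real,
        Real.norm_eq_abs, one_mul, mul_one]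
    exact hub l hl
  rw [eq_sub_of_add_eq hFTC]
  refine (norm_sub_le _ _).trans ?_
  have := norm_sub_le (-Complex.I * ((u q : ℂ) * quadPhase x τ q))
    (-Complex.I * ((u p : ℂ) * quadPhase x τ p))
  have h5 : 5 * w p / m = 5 * (w p / m) := by ring
  rw [h5]
  linarith [hn p hp, hn q hq]

/-- A positive `C¹` decreasing amplitude on `(0, ∞)` dominated by `λ^{-1/2}`. -/
structure IsDecayAmplitude (w w' : ℝ → ℝ) : Prop where
  hasDerivAt : ∀ l, 0 < l → HasDerivAt w (w' l) l
  continuousOn_deriv : ContinuousOn w' (Set.Ioi 0)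
  deriv_nonpos : ∀ l, 0 < l → w' l ≤ 0
  nonneg : ∀ l, 0 < l → 0 ≤ w l
  mul_sqrt_le : ∀ l, 0 < l → w l * √l ≤ 1

namespace IsDecayAmplitude

variable {w w' : ℝ → ℝ}

theorem continuousOn (h : IsDecayAmplitude w w') : ContinuousOn w (Set.Ioi 0) := fun l hl =>
  (h.hasDerivAt l hl).continuousAt.continuousWithinAt

theorem antitone (h : IsDecayAmplitude w w') {p q : ℝ} (hp : 0 < p) (hpq : p ≤ q) : w q ≤ w p := by
  refine antitoneOn_of_deriv_nonpos (convex_Ioi (0 : ℝ)) h.continuousOn ?_ ?_ hp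
    (hp.trans_le hpq) hpq
  · exact fun y hy =>
      (h.hasDerivAt y (interior_subset hy)).differentiableAt.differentiableWithinAt
  · intro y hy
    rw [(h.hasDerivAt y (interior_subset hy)).deriv]
    exact h.deriv_nonpos y (interior_subset hy)

theorem intervalIntegrable (h : IsDecayAmplitude w w') (x τ : ℝ) {p q : ℝ} (hp : 0 < p)
    (hpq : p ≤ q) : IntervalIntegrable (fun l => (w l : ℂ) * quadPhase x τ l) volume p q := by
  apply ContinuousOn.intervalIntegrable
  rw [Set.uIcc_of_le hpq]
  refine (Complex.continuous_ofReal.comp_continuousOn (h.continuousOn.mono ?_)).mul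
    (continuous_quadPhase x τ).continuousOn
  exact fun l hl => hp.trans_le hl.1

theorem norm_integral_le_first (h : IsDecayAmplitude w w') {x τ m p q : ℝ} (hp : 0 < p)
    (hpq : p ≤ q) (hm : 0 < m) (hφ : ∀ l ∈ Set.Icc p q, m ≤ |x + 2 * τ * l|) :
    ‖∫ l in p..q, (w l : ℂ) * quadPhase x τ l‖ ≤ 5 * w p / m :=
  norm_integral_quadPhase_le_of_le_abs_deriv hpq hm
    (fun l hl => h.hasDerivAt l (hp.trans_le hl.1))
    (h.continuousOn_deriv.mono fun _ hl => hp.trans_le hl.1)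
    (fun l hl => h.deriv_nonpos l (hp.trans_le hl.1))
    (fun l hl => h.nonneg l (hp.trans_le hl.1)) hφ

theorem norm_integral_le_second (h : IsDecayAmplitude w w') {x τ p q : ℝ} (hp : 0 < p)
    (hpq : p ≤ q) (hτ : τ ≠ 0) :
    ‖∫ l in p..q, (w l : ℂ) * quadPhase x τ l‖ ≤ 12 * (w p / √|τ|) := by
  have hτ' : 0 < |τ| := abs_pos.2 hτ
  set σ := √|τ| with hσ
  have hσ0 : 0 < σ := Real.sqrt_pos.2 hτ'
  have hσ2 : σ * σ = |τ| := Real.mul_self_sqrt hτ'.le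
  have hwp := h.nonneg p hp
  set l₀ := -x / (2 * τ) with hl₀
  have hlin : ∀ l, |x + 2 * τ * l| = 2 * (σ * σ) * |l - l₀| := by
    intro l
    have : x + 2 * τ * l = 2 * τ * (l - l₀) := by rw [hl₀]; field_simp; ring
    rw [this, abs_mul, abs_mul, abs_two, hσ2]
  have hfar : ∀ a b, p ≤ a → a ≤ b → (∀ l ∈ Set.Icc a b, 1 / σ ≤ |l - l₀|) →
      ‖∫ l in a..b, (w l : ℂ) * quadPhase x τ l‖ ≤ 5 * (w p / σ) := by
    intro a b hpa hab hl
    refine (h.norm_integral_le_first (hp.trans_le hpa) hab hσ0 ?_).trans ?_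
    · intro l hl'
      rw [hlin]
      have h1 : 2 * (σ * σ) * (1 / σ) ≤ 2 * (σ * σ) * |l - l₀| := by
        gcongr; exact hl l hl'
      have h2 : 2 * (σ * σ) * (1 / σ) = 2 * σ := by field_simp
      linarith
    · rw [mul_div_assoc]
      gcongr
      exact h.antitone hp hpa
  have := norm_integral_le_add_of_split_s7 (K₁ := 5 * (w p / σ)) (K₂ := 2 * (w p / σ) + 5 * (w p / σ))
    (c := l₀ - 1 / σ) hpq (h.intervalIntegrable x τ hp hpq) (by positivity) (by positivity) ?_ ?_
  · linarith
  · intro a b hpa hab _ hbc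
    refine hfar a b hpa hab fun l hl => ?_
    rw [abs_sub_comm]
    exact le_trans (by linarith [hl.2]) (le_abs_self _)
  · intro a b hpa hab _ hca
    refine norm_integral_le_add_of_split_s7 (c := l₀ + 1 / σ) hab
      (h.intervalIntegrable x τ (hp.trans_le hpa) hab) (by positivity) (by positivity) ?_ ?_
    · intro a' b' haa hab' _ hbc
      refine (intervalIntegral.norm_integral_le_of_norm_le_const (C := w p) ?_).trans ?_
      · intro l hl
        rw [Set.uIoc_of_le hab'] at hl
        have hpl : p ≤ l := hpa.trans (haa.trans hl.1.le)
        rw [norm_mul, norm_quadPhase, mul_one, Complex.norm_real, Real.norm_eq_abs,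
          abs_of_nonneg (h.nonneg l (hp.trans_le hpl))]
        exact h.antitone hp hpl
      · rw [abs_of_nonneg (sub_nonneg.2 hab')]
        have : b' - a' ≤ 2 * (1 / σ) := by linarith
        calc w p * (b' - a') ≤ w p * (2 * (1 / σ)) := by gcongr
          _ = _ := by ring
    · intro a' b' haa hab' _ hca'
      refine hfar a' b' (hpa.trans haa) hab' fun l hl => ?_
      exact le_trans (by linarith [hl.1]) (le_abs_self _)

theorem le_one_div_sqrt (h : IsDecayAmplitude w w') {l : ℝ} (hl : 0 < l) : w l ≤ 1 / √l := by
  rw [le_div_iff₀ (Real.sqrt_pos.2 hl)]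
  exact h.mul_sqrt_le l hl

theorem norm_integral_le (h : IsDecayAmplitude w w') {x τ p q : ℝ} (hp : 0 < p)
    (hpq : p ≤ q) (hx : x ≠ 0) :
    ‖∫ l in p..q, (w l : ℂ) * quadPhase x τ l‖ ≤ 41 * (1 / √|x|) := by
  have hx' : 0 < |x| := abs_pos.2 hx
  set ξ := √|x| with hξ
  have hξ0 : 0 < ξ := Real.sqrt_pos.2 hx'
  have hξ2 : ξ * ξ = |x| := Real.mul_self_sqrt hx'.le
  have hK : 0 ≤ 1 / ξ := by positivity
  have hfirst : ∀ m : ℝ, 0 < m → ∀ a b, p ≤ a → a ≤ b → 1 / |x| ≤ a →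
      (∀ l ∈ Set.Icc a b, |x| / m ≤ |x + 2 * τ * l|) →
      ‖∫ l in a..b, (w l : ℂ) * quadPhase x τ l‖ ≤ 5 * m * (1 / ξ) := by
    intro m hm a b hpa hab hxa hl
    have ha := hp.trans_le hpa
    refine (h.norm_integral_le_first ha hab (div_pos hx' hm) hl).trans ?_
    have hwa : w a ≤ ξ := by
      have h1 := h.antitone (one_div_pos.2 hx') hxa
      have h2 := h.le_one_div_sqrt (one_div_pos.2 hx')
      rw [Real.sqrt_div zero_le_one, Real.sqrt_one, one_div_one_div] at h2
      exact h1.trans h2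
    calc 5 * w a / (|x| / m) ≤ 5 * ξ / (|x| / m) := by gcongr
      _ = 5 * m * (1 / ξ) := by rw [← hξ2]; field_simp
  have hmain : ∀ a b, p ≤ a → a ≤ b → 1 / |x| ≤ a →
      ‖∫ l in a..b, (w l : ℂ) * quadPhase x τ l‖ ≤ 39 * (1 / ξ) := by
    intro a b hpa hab hxa
    have ha := hp.trans_le hpa
    rcases le_or_gt 0 (x * τ) with hs | hs
    · refine (hfirst 1 one_pos a b hpa hab hxa fun l hl => ?_).trans (by linarith)
      have hl0 := ha.trans_le hl.1
      rw [div_one]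
      apply sq_le_sq.1
      nlinarith [mul_nonneg hs hl0.le, sq_nonneg (τ * l)]
    · have hτ : τ ≠ 0 := by rintro rfl; simp at hs
      have hτ' : 0 < |τ| := abs_pos.2 hτ
      set l₀ := -x / (2 * τ) with hl₀
      have hlin : ∀ l, |x + 2 * τ * l| = 2 * |τ| * |l - l₀| := by
        intro l
        have : x + 2 * τ * l = 2 * τ * (l - l₀) := by rw [hl₀]; field_simp; ring
        rw [this, abs_mul, abs_mul, abs_two]
      have hl₀p : 0 < l₀ := by
        have : l₀ = -(x * τ) / (2 * τ ^ 2) := by rw [hl₀]; field_simp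
        rw [this]
        have : 0 < τ ^ 2 := by positivity
        exact div_pos (by linarith) (by linarith)
      have hxl : |x| = 2 * |τ| * l₀ := by
        have := hlin 0
        simpa [abs_of_pos hl₀p] using this
      have := norm_integral_le_add_of_split_s7 (K₁ := 5 * 2 * (1 / ξ))
        (K₂ := 24 * (1 / ξ) + 5 * 1 * (1 / ξ))
        (c := l₀ / 2) hab (h.intervalIntegrable x τ ha hab) (by positivity) (by positivity) ?_ ?_
      · linarith
      · intro a' b' haa hab' _ hbc
        refine hfirst 2 two_pos a' b' (hpa.trans haa) hab' (hxa.trans haa) fun l hl => ?_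
        rw [hlin, hxl, abs_sub_comm, mul_div_assoc]
        gcongr
        exact le_trans (by linarith [hl.2]) (le_abs_self _)
      · intro a' b' haa hab' _ hca
        refine norm_integral_le_add_of_split_s7 (c := 2 * l₀) hab'
          (h.intervalIntegrable x τ (ha.trans_le haa) hab') (by positivity) (by positivity) ?_ ?_
        · intro a₁ b₁ haa₁ hab₁ _ _
          have ha₁ : 0 < a₁ := ha.trans_le (haa.trans haa₁)
          refine (h.norm_integral_le_second ha₁ hab₁ hτ).trans ?_
          have h1 : w a₁ / √|τ| ≤ 2 * (1 / ξ) := by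
            calc w a₁ / √|τ| ≤ 1 / √a₁ / √|τ| := by gcongr; exact h.le_one_div_sqrt ha₁
              _ = 1 / √(a₁ * |τ|) := by rw [Real.sqrt_mul ha₁.le, div_div]
              _ ≤ 1 / (ξ / 2) := by
                apply one_div_le_one_div_of_le (by positivity)
                apply Real.le_sqrt_of_sq_le
                have : (ξ / 2) ^ 2 = l₀ / 2 * |τ| := by
                  rw [div_pow, sq, hξ2, hxl]; ring
                rw [this]
                gcongr
                linarith
              _ = 2 * (1 / ξ) := by field_simp
          linarith
        · intro a₁ b₁ haa₁ hab₁ _ hca₁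
          refine hfirst 1 one_pos a₁ b₁ (hpa.trans (haa.trans haa₁)) hab₁
            (hxa.trans (haa.trans haa₁)) fun l hl => ?_
          rw [hlin, hxl, div_one]
          gcongr
          exact le_trans (by linarith [hl.1]) (le_abs_self _)
  have := norm_integral_le_add_of_split_s7 (K₁ := 2 * (1 / ξ)) (K₂ := 39 * (1 / ξ))
    (c := 1 / |x|) hpq (h.intervalIntegrable x τ hp hpq) (by positivity) (by positivity) ?_ ?_
  · linarith
  · intro a b hpa hab _ hbc
    have ha := hp.trans_le hpa
    have hsqrt : ∀ l ∈ Set.uIcc a b, HasDerivAt (fun l => 2 * √l) (1 / √l) l := by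
      intro l hl
      rw [Set.uIcc_of_le hab] at hl
      have hl0 := ha.trans_le hl.1
      refine ((Real.hasDerivAt_sqrt hl0.ne').const_mul 2).congr_deriv ?_
      have := Real.sqrt_pos.2 hl0
      field_simp
    have hsi : IntervalIntegrable (fun l => 1 / √l) volume a b := by
      apply ContinuousOn.intervalIntegrable
      rw [Set.uIcc_of_le hab]
      refine continuousOn_const.div Real.continuous_sqrt.continuousOn fun l hl => ?_
      exact (Real.sqrt_pos.2 (ha.trans_le hl.1)).ne'
    refine (intervalIntegral.norm_integral_le_of_norm_le hab (Filter.Eventually.of_forall ?_)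
      hsi).trans ?_
    · intro l hl
      have hl0 := ha.trans hl.1
      rw [norm_mul, norm_quadPhase, mul_one, Complex.norm_real, Real.norm_eq_abs,
          abs_of_nonneg (h.nonneg l hl0)]
      exact h.le_one_div_sqrt hl0
    · rw [intervalIntegral.integral_eq_sub_of_hasDerivAt hsqrt hsi]
      have h1 := Real.sqrt_le_sqrt hbc
      rw [Real.sqrt_div zero_le_one, Real.sqrt_one] at h1
      linarith [Real.sqrt_nonneg a]
  · intro a b hpa hab _ hca
    exact hmain a b hpa hab hca

end IsDecayAmplitude

theorem isDecayAmplitude_rpow {c : ℝ} (hc : 0 ≤ c) :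
    IsDecayAmplitude (fun l => (l ^ 2 + c) ^ (-(1 / 4 : ℝ)))
      (fun l => 2 * l * (-(1 / 4 : ℝ)) * (l ^ 2 + c) ^ (-(1 / 4 : ℝ) - 1)) where
  hasDerivAt l hl := by
    have h : HasDerivAt (fun l : ℝ => l ^ 2 + c) (2 * l) l := by
      simpa using (hasDerivAt_pow 2 l).add_const c
    exact h.rpow_const (Or.inl (by positivity))
  continuousOn_deriv := by
    refine ContinuousOn.mul (by fun_prop) (ContinuousOn.rpow_const (by fun_prop) ?_)
    intro l (hl : 0 < l)
    exact Or.inl (by positivity)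
  deriv_nonpos l hl := by
    have : 0 ≤ (l ^ 2 + c) ^ (-(1 / 4 : ℝ) - 1) := by positivity
    nlinarith
  nonneg l hl := by positivity
  mul_sqrt_le l hl := by
    have h1 : (l ^ 2 + c) ^ (-(1 / 4 : ℝ)) ≤ (l ^ 2) ^ (-(1 / 4 : ℝ)) :=
      Real.rpow_le_rpow_of_nonpos (by positivity) (by linarith) (by norm_num)
    have h2 : (l ^ 2) ^ (-(1 / 4 : ℝ)) = (√l)⁻¹ := by
      rw [Real.sqrt_eq_rpow, ← Real.rpow_natCast, ← Real.rpow_mul hl.le, ← Real.rpow_neg hl.le]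
      norm_num
    have h3 := Real.sqrt_pos.2 hl
    calc _ ≤ (√l)⁻¹ * √l := by gcongr; exact h1.trans h2.le
      _ = 1 := inv_mul_cancel₀ h3.ne'

theorem Measurable.quadPhase {α : Type*} [MeasurableSpace α] {x τ l : α → ℝ}
    (hx : Measurable x) (hτ : Measurable τ) (hl : Measurable l) :
    Measurable fun a => quadPhase (x a) (τ a) (l a) := by
  unfold _root_.quadPhase
  fun_prop

theorem quadPhase_mul_conj (x y σ τ l : ℝ) :
    quadPhase x σ l * (starRingEnd ℂ) (quadPhase y τ l) = quadPhase (x - y) (σ - τ) l := by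
  unfold quadPhase
  rw [← Complex.exp_conj, ← Complex.exp_add]
  congr 1
  simp only [map_mul, Complex.conj_I, Complex.conj_ofReal]
  push_cast
  ring

theorem lintegral_one_div_sqrt_abs_lt_top (R : ℝ) :
    ∫⁻ y in Set.Ioc (-R) R, ENNReal.ofReal (1 / √|y|) < ⊤ := by
  have h : IntervalIntegrable (fun y : ℝ => 1 / √|y|) volume (-R) R := by
    refine intervalIntegrable_of_even (fun x => by rw [abs_neg]) fun x hx => ?_
    refine (intervalIntegral.intervalIntegrable_rpow' (r := -(1 / 2)) (by norm_num)).congr ?_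
    intro y hy
    rw [Set.uIoc_of_le hx.le] at hy
    simp only
    rw [abs_of_pos hy.1, Real.sqrt_eq_rpow, Real.rpow_neg hy.1.le, one_div, one_div]
  have h' := h.1
  exact (hasFiniteIntegral_iff_ofReal (Filter.Eventually.of_forall fun y => by positivity)).1
    h'.hasFiniteIntegral

theorem lintegral_one_div_sqrt_abs_sub_le {R s : ℝ} (hs : s ∈ Set.Ioc 0 R) :
    ∫⁻ y in Set.Ioc 0 R, ENNReal.ofReal (1 / √|s - y|) ≤
      ∫⁻ y in Set.Ioc (-R) R, ENNReal.ofReal (1 / √|y|) := by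
  rw [← lintegral_indicator measurableSet_Ioc, ← lintegral_indicator measurableSet_Ioc,
    ← lintegral_sub_left_eq_self
      ((Set.Ioc (-R) R).indicator fun y => ENNReal.ofReal (1 / √|y|)) s]
  refine lintegral_mono fun y => ?_
  by_cases hy : y ∈ Set.Ioc 0 R
  · have : s - y ∈ Set.Ioc (-R) R := ⟨by linarith [hs.1, hy.2], by linarith [hs.2, hy.1]⟩
    rw [Set.indicator_of_mem hy, Set.indicator_of_mem this]
  · rw [Set.indicator_of_notMem hy]
    exact zero_le

namespace IsDecayAmplitude

variable {w w' : ℝ → ℝ}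

/-- The kernel bound for the truncated oscillating factors. -/
theorem norm_setIntegral_truncated_le (h : IsDecayAmplitude w w') {B R N M x y σ τ : ℝ}
    {a b : ℂ} (hB : 0 < B) (hx : x ∈ Set.Ioc 0 R) (hy : y ∈ Set.Ioc 0 R)
    (hxy : x ≠ y) (ha : ‖a‖ ≤ M) (hb : ‖b‖ ≤ M) :
    ‖∫ l in Set.Ioc (B / R) N, (w l : ℂ) * ((if B < x * l then a * quadPhase x σ l else 0) *
        (starRingEnd ℂ) (if B < y * l then b * quadPhase y τ l else 0))‖ ≤
      41 * M ^ 2 * (1 / √|x - y|) := by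
  have hM : 0 ≤ M := (norm_nonneg _).trans ha
  set p := max (B / x) (B / y) with hp
  have hp0 : 0 < p := lt_max_of_lt_left (div_pos hB hx.1)
  have hBR : B / R ≤ p := le_max_of_le_left (div_le_div_of_nonneg_left hB.le hx.1 hx.2)
  have hfun : (fun l : ℝ => (w l : ℂ) * ((if B < x * l then a * quadPhase x σ l else 0) *
        (starRingEnd ℂ) (if B < y * l then b * quadPhase y τ l else 0))) =
      (Set.Ioi p).indicator fun l => (a * (starRingEnd ℂ) b) *
        ((w l : ℂ) * quadPhase (x - y) (σ - τ) l) := by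
    funext l
    have hiff : l ∈ Set.Ioi p ↔ B < x * l ∧ B < y * l := by
      rw [Set.mem_Ioi, hp, max_lt_iff, div_lt_iff₀ hx.1, div_lt_iff₀ hy.1, mul_comm x, mul_comm y]
    by_cases hl : l ∈ Set.Ioi p
    · rw [Set.indicator_of_mem hl, if_pos (hiff.1 hl).1, if_pos (hiff.1 hl).2,
        ← quadPhase_mul_conj, map_mul]
      ring
    · rw [Set.indicator_of_notMem hl]
      rw [hiff, not_and_or] at hl
      rcases hl with hl | hl <;> simp [hl]
  rw [hfun, setIntegral_indicator measurableSet_Ioi, Set.Ioc_inter_Ioi, max_eq_right hBR,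
    integral_const_mul, norm_mul, norm_mul, RCLike.norm_conj]
  have hK : ‖∫ l in Set.Ioc p N, (w l : ℂ) * quadPhase (x - y) (σ - τ) l‖ ≤
      41 * (1 / √|x - y|) := by
    rcases le_or_gt p N with hpN | hpN
    · rw [← intervalIntegral.integral_of_le hpN]
      exact h.norm_integral_le hp0 hpN (sub_ne_zero.2 hxy)
    · rw [Set.Ioc_eq_empty_of_le hpN.le]
      simp only [Measure.restrict_empty, integral_zero_measure, norm_zero]
      positivity
  calc _ ≤ M * M * (41 * (1 / √|x - y|)) := by gcongr
    _ = _ := by ring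

theorem lintegral_Ioc_le (h : IsDecayAmplitude w w') (hwm : Measurable w) {B R N M : ℝ}
    (hB : 0 < B) (hR : 0 < R) {ψ : ℝ → ℂ} {t : ℝ → ℝ} (hψ : Measurable ψ) (ht : Measurable t)
    (hψM : ∀ s ∈ Set.Ioc 0 R, ‖ψ s‖ ≤ M) :
    ∫⁻ l in Set.Ioc (B / R) N, ENNReal.ofReal (w l) *
        ‖∫ s in (B / l)..R, ψ s * quadPhase s (t s) l‖ₑ ^ 2 ≤
      ENNReal.ofReal (41 * M ^ 2) * (∫⁻ y in Set.Ioc (-R) R, ENNReal.ofReal (1 / √|y|)) *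
        ENNReal.ofReal R := by
  have hM : 0 ≤ M := (norm_nonneg _).trans (hψM R ⟨hR, le_rfl⟩)
  have hBR : 0 < B / R := div_pos hB hR
  set μ : Measure ℝ := volume.restrict (Set.Ioc 0 R) with hμ
  set ν : Measure ℝ := volume.restrict (Set.Ioc (B / R) N) with hν
  set G : ℝ → ℝ → ℂ := fun s l => if B < s * l then ψ s * quadPhase s (t s) l else 0 with hG
  have hGm : Measurable fun z : ℝ × ℝ => G z.1 z.2 := by
    refine Measurable.ite (measurableSet_lt measurable_const (by fun_prop)) ?_ measurable_const
    exact (hψ.comp measurable_fst).mul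
      (Measurable.quadPhase measurable_fst (ht.comp measurable_fst) measurable_snd)
  have hGn : ∀ s ∈ Set.Ioc 0 R, ∀ l, ‖G s l‖ ≤ M := by
    intro s hs l
    simp only [hG]
    split_ifs
    · rw [norm_mul, norm_quadPhase, mul_one]; exact hψM s hs
    · simpa using hM
  have hGint : ∀ l ∈ Set.Ioc (B / R) N,
      ∫ s in (B / l)..R, ψ s * quadPhase s (t s) l = ∫ s, G s l ∂μ := by
    intro l hl
    have hl0 : 0 < l := hBR.trans hl.1
    have hle : B / l ≤ R := by
      rw [div_le_iff₀ hl0, mul_comm, ← div_le_iff₀ hR]; exact hl.1.le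
    rw [intervalIntegral.integral_of_le hle]
    have : (fun s => G s l) = (Set.Ioi (B / l)).indicator fun s => ψ s * quadPhase s (t s) l := by
      funext s
      simp only [hG, Set.indicator_apply, Set.mem_Ioi, div_lt_iff₀ hl0]
    rw [this, hμ, setIntegral_indicator measurableSet_Ioi, Set.Ioc_inter_Ioi,
      max_eq_right (div_pos hB hl0).le]
  set Φ : (ℝ × ℝ) → ℝ → ℂ := fun z l => (w l : ℂ) * (G z.1 l * (starRingEnd ℂ) (G z.2 l)) with hΦ
  have hΦm : Measurable (Function.uncurry Φ) := by
    have h1 : Measurable fun z : (ℝ × ℝ) × ℝ => G z.1.1 z.2 :=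
      hGm.comp (measurable_fst.fst.prodMk measurable_snd)
    have h2 : Measurable fun z : (ℝ × ℝ) × ℝ => G z.1.2 z.2 :=
      hGm.comp (measurable_fst.snd.prodMk measurable_snd)
    exact (Complex.measurable_ofReal.comp (hwm.comp measurable_snd)).mul
      (h1.mul (Complex.continuous_conj.measurable.comp h2))
  have hmem : ∀ᵐ z : (ℝ × ℝ) × ℝ ∂((μ.prod μ).prod ν),
      z ∈ (Set.Ioc 0 R ×ˢ Set.Ioc 0 R) ×ˢ Set.Ioc (B / R) N := by
    rw [hμ, hν, Measure.prod_restrict, Measure.prod_restrict]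
    exact ae_restrict_mem ((measurableSet_Ioc.prod measurableSet_Ioc).prod measurableSet_Ioc)
  have hΦi : Integrable (Function.uncurry Φ) ((μ.prod μ).prod ν) := by
    refine Integrable.of_bound hΦm.aestronglyMeasurable (w (B / R) * (M * M)) ?_
    filter_upwards [hmem] with z hz
    have hl : 0 < z.2 := hBR.trans hz.2.1
    simp only [Function.uncurry, hΦ, norm_mul, RCLike.norm_conj, Complex.norm_real,
      Real.norm_eq_abs, abs_of_nonneg (h.nonneg _ hl)]
    have h1 := hGn _ hz.1.1 z.2
    have h2 := hGn _ hz.1.2 z.2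
    have h3 := h.nonneg _ hBR
    gcongr
    exact h.antitone hBR hz.2.1.le
  have hI : ∀ l, ∫ z, Φ z l ∂(μ.prod μ) = ((w l * ‖∫ s, G s l ∂μ‖ ^ 2 : ℝ) : ℂ) := by
    intro l
    simp only [hΦ]
    rw [integral_const_mul,
      integral_prod_mul (fun s => G s l) (fun s => (starRingEnd ℂ) (G s l)), integral_conj,
      Complex.mul_conj, Complex.normSq_eq_norm_sq]
    push_cast
    rfl
  have hIi : Integrable (fun l => w l * ‖∫ s, G s l ∂μ‖ ^ 2) ν := by
    have := hΦi.integral_prod_right.re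
    refine this.congr (Filter.Eventually.of_forall fun l => ?_)
    change RCLike.re (∫ z, Φ z l ∂(μ.prod μ)) = _
    rw [hI]
    exact Complex.ofReal_re _
  have hstep : ∫⁻ l in Set.Ioc (B / R) N, ENNReal.ofReal (w l) *
        ‖∫ s in (B / l)..R, ψ s * quadPhase s (t s) l‖ₑ ^ 2 =
      ‖∫ l, ∫ z, Φ z l ∂(μ.prod μ) ∂ν‖ₑ := by
    have hnn : 0 ≤ᵐ[ν] fun l => w l * ‖∫ s, G s l ∂μ‖ ^ 2 := by
      filter_upwards [ae_restrict_mem measurableSet_Ioc] with l hl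
      exact mul_nonneg (h.nonneg l (hBR.trans hl.1)) (sq_nonneg _)
    simp_rw [hI]
    rw [integral_complex_ofReal, ← ofReal_norm, Complex.norm_real, Real.norm_eq_abs,
      abs_of_nonneg (integral_nonneg_of_ae hnn), ofReal_integral_eq_lintegral_ofReal hIi hnn]
    refine setLIntegral_congr_fun measurableSet_Ioc fun l hl => ?_
    rw [hGint l hl, ENNReal.ofReal_mul (h.nonneg l (hBR.trans hl.1)),
      ENNReal.ofReal_pow (norm_nonneg _), ofReal_norm]
  rw [hstep, ← integral_integral_swap hΦi]
  refine (enorm_integral_le_lintegral_enorm _).trans ((lintegral_prod_le _).trans ?_)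
  have hin : ∀ s ∈ Set.Ioc 0 R, ∫⁻ y, ‖∫ l, Φ (s, y) l ∂ν‖ₑ ∂μ ≤
      ENNReal.ofReal (41 * M ^ 2) * ∫⁻ y in Set.Ioc (-R) R, ENNReal.ofReal (1 / √|y|) := by
    intro s hs
    calc ∫⁻ y, ‖∫ l, Φ (s, y) l ∂ν‖ₑ ∂μ
        ≤ ∫⁻ y, ENNReal.ofReal (41 * M ^ 2) * ENNReal.ofReal (1 / √|s - y|) ∂μ := by
          refine lintegral_mono_ae ?_
          have hne : ∀ᵐ y ∂μ, y ≠ s := ae_restrict_of_ae (Measure.ae_ne volume s)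
          filter_upwards [ae_restrict_mem measurableSet_Ioc, hne] with y hy hys
          rw [← ENNReal.ofReal_mul (by positivity), ← ofReal_norm]
          exact ENNReal.ofReal_le_ofReal
            (h.norm_setIntegral_truncated_le hB hs hy hys.symm (hψM s hs) (hψM y hy))
      _ = ENNReal.ofReal (41 * M ^ 2) * ∫⁻ y, ENNReal.ofReal (1 / √|s - y|) ∂μ :=
          lintegral_const_mul _ (by fun_prop)
      _ ≤ _ := mul_le_mul_right (lintegral_one_div_sqrt_abs_sub_le hs) _
  refine (setLIntegral_mono measurable_const hin).trans ?_
  rw [setLIntegral_const, Real.volume_Ioc, sub_zero]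

theorem lintegral_Ioi_le (h : IsDecayAmplitude w w') (hwm : Measurable w) {B R M : ℝ}
    (hB : 0 < B) (hR : 0 < R) {ψ : ℝ → ℂ} {t : ℝ → ℝ} (hψ : Measurable ψ) (ht : Measurable t)
    (hψM : ∀ s ∈ Set.Ioc 0 R, ‖ψ s‖ ≤ M) :
    ∫⁻ l in Set.Ioi (B / R), ENNReal.ofReal (w l) *
        ‖∫ s in (B / l)..R, ψ s * quadPhase s (t s) l‖ₑ ^ 2 ≤
      ENNReal.ofReal (41 * M ^ 2) * (∫⁻ y in Set.Ioc (-R) R, ENNReal.ofReal (1 / √|y|)) *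
        ENNReal.ofReal R := by
  have hU : Set.Ioi (B / R) = ⋃ n : ℕ, Set.Ioc (B / R) (n : ℝ) := by
    ext l
    simp only [Set.mem_Ioi, Set.mem_iUnion, Set.mem_Ioc, exists_and_left]
    exact ⟨fun hl => ⟨hl, exists_nat_ge l⟩, fun hl => hl.1⟩
  rw [hU, setLIntegral_iUnion_of_directed]
  · exact iSup_le fun n => h.lintegral_Ioc_le hwm hB hR hψ ht hψM
  · refine Monotone.directed_le fun m n hmn => Set.Ioc_subset_Ioc_right ?_
    exact_mod_cast hmn

end IsDecayAmplitude

theorem continuous_radialDensity (mv mz : ℕ) : Continuous (radialDensity mv mz) := by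
  unfold radialDensity
  fun_prop

/-- **Finiteness of the integrals `G₁`, `G₂`.**
Let `mv` be a positive even integer, `mz` a positive integer, `Q = mv/2 + mz`, `B > 2`,
`R > 0`. There is `C > 0` (depending only on `mv`, `mz`, `B`, `R`) such that for every
measurable `t : (0,∞) → (0, 4/Q²)` and every measurable unimodular `θ : (0,R] → ℂ`:
`∫_{B/R}^∞ (λ²+Q²/4)^{-1/4} |∫_{B/λ}^R θ(s) A(s)^{1/2} e^{i(λs + t(s)(λ²+Q²/4))} ds|² dλ ≤ C`. -/
theorem G1_G2_finiteness
    (mv mz : ℕ) (hmv : 0 < mv) (hmv_even : Even mv) (hmz : 0 < mz)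
    (B R : ℝ) (hB : 2 < B) (hR : 0 < R) :
    ∃ C : ℝ, 0 < C ∧
      ∀ t : ℝ → ℝ, Measurable t →
        (∀ u : ℝ, 0 < u → t u ∈ Set.Ioo 0 (4 / homDim mv mz ^ 2)) →
      ∀ θ : ℝ → ℂ, Measurable θ → (∀ s ∈ Set.Ioc (0:ℝ) R, ‖θ s‖ = 1) →
      (∫⁻ l in Set.Ioi (B / R),
          ENNReal.ofReal ((l ^ 2 + homDim mv mz ^ 2 / 4) ^ (-(1 / 4 : ℝ))) *
            (‖∫ s in (B / l)..R,
                θ s * ((radialDensity mv mz s ^ ((1:ℝ)/2) : ℝ) : ℂ) *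
                  Complex.exp (Complex.I *
                    ((l * s + t s * (l ^ 2 + homDim mv mz ^ 2 / 4) : ℝ) : ℂ))‖₊ : ℝ≥0∞) ^ 2)
        ≤ ENNReal.ofReal C := by
  have hc : 0 ≤ homDim mv mz ^ 2 / 4 := by positivity
  set c := homDim mv mz ^ 2 / 4 with hc_def
  have hA : Continuous fun s => radialDensity mv mz s ^ ((1 : ℝ) / 2) :=
    (continuous_radialDensity mv mz).rpow_const fun _ => Or.inr (by norm_num)
  obtain ⟨M, hM⟩ := (isCompact_Icc (a := (0 : ℝ)) (b := R)).exists_bound_of_continuousOn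
    hA.continuousOn
  set D : ℝ≥0∞ := ENNReal.ofReal (41 * M ^ 2) *
    (∫⁻ y in Set.Ioc (-R) R, ENNReal.ofReal (1 / √|y|)) * ENNReal.ofReal R with hD
  have hDtop : D ≠ ⊤ := ENNReal.mul_ne_top
    (ENNReal.mul_ne_top ENNReal.ofReal_ne_top (lintegral_one_div_sqrt_abs_lt_top R).ne)
    ENNReal.ofReal_ne_top
  refine ⟨D.toReal + 1, by positivity, fun t ht _ θ hθ hθ1 => ?_⟩
  set ψ : ℝ → ℂ := fun s => θ s * ((radialDensity mv mz s ^ ((1 : ℝ) / 2) : ℝ) : ℂ) *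
    Complex.exp (((t s * c : ℝ) : ℂ) * Complex.I) with hψ_def
  have hψ : Measurable ψ := by
    have := hA.measurable
    fun_prop
  have hψM : ∀ s ∈ Set.Ioc 0 R, ‖ψ s‖ ≤ M := by
    intro s hs
    rw [hψ_def, norm_mul, norm_mul, hθ1 s hs, one_mul, Complex.norm_exp_ofReal_mul_I, mul_one,
      Complex.norm_real]
    exact hM s (Set.Ioc_subset_Icc_self hs)
  have hwm : Measurable fun l : ℝ => (l ^ 2 + c) ^ (-(1 / 4 : ℝ)) := by fun_prop
  have key := (isDecayAmplitude_rpow hc).lintegral_Ioi_le hwm (by linarith : 0 < B) hR hψ ht hψM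
  have hfun : ∀ l s : ℝ, θ s * ((radialDensity mv mz s ^ ((1:ℝ)/2) : ℝ) : ℂ) *
      Complex.exp (Complex.I * ((l * s + t s * (l ^ 2 + c) : ℝ) : ℂ)) =
      ψ s * quadPhase s (t s) l := by
    intro l s
    rw [hψ_def, quadPhase, mul_assoc (θ s * _), ← Complex.exp_add]
    congr 2
    push_cast
    ring
  simp only [hfun]
  refine key.trans ?_
  rw [← hD, ← ENNReal.ofReal_toReal hDtop]
  exact ENNReal.ofReal_le_ofReal (by rw [ENNReal.toReal_ofReal ENNReal.toReal_nonneg]; linarith)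
end
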